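/- arXiv:1212.1905 — 6 statements merged into one kernel-verified Lean document; each statement's English description precedes it below -/
import Mathlib

section
/- Fix an integer k ≥ 4, set α_k = e·k^{−k/(k−2)}, σ_k = 1.7·α_k³/(1 + e^k), and let λ_k be the unique positive root of ψ(λ) = k. Define, for α ∈ (0,1) and λ > 0, H_k(α; λ) = (ψ(λ)/k)·H(α) + ln[(1 + f(λ(1−2α))/f(λ))/2]. Then for every α ∈ [0.99·α_k, 1/2] and every λ ∈ (0, λ_k], if H_k(α; λ) ≥ 0 then ∂H_k(α; λ)/∂λ ≥ σ_k. -/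
/-- `f(x) = e^x - 1 - x` (so `f(0) = 0`). -/
noncomputable def fEx (x : ℝ) : ℝ := Real.exp x - 1 - x

/-- `ψ(x) = x (e^x - 1) / (e^x - 1 - x)` for `x ≠ 0`, extended by `ψ(0) = 2`. -/
noncomputable def psi (x : ℝ) : ℝ :=
  if x = 0 then 2 else x * (Real.exp x - 1) / (Real.exp x - 1 - x)

/-- The entropy function `H(α) = -α ln α - (1-α) ln(1-α)`. -/
noncomputable def Hent (a : ℝ) : ℝ := -(a * Real.log a) - (1 - a) * Real.log (1 - a)

/-- `H_k(α; λ) = (ψ(λ)/k) H(α) + ln[(1 + f(λ(1-2α))/f(λ))/2]`. -/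
noncomputable def HkAl (k : ℕ) (a lam : ℝ) : ℝ :=
  psi lam / k * Hent a + Real.log ((1 + fEx (lam * (1 - 2 * a)) / fEx lam) / 2)

/-- `α_k = e k^{-k/(k-2)}`. -/
noncomputable def alphaK (k : ℕ) : ℝ :=
  Real.exp 1 * (k : ℝ) ^ (-(k : ℝ) / ((k : ℝ) - 2))

lemma hs_aux (y c : ℝ) (j : ℕ) :
    HasSum (fun n : ℕ => ((n.descFactorial j : ℝ) * c ^ (n - j)) * (y ^ n / n.factorial))
      (y ^ j * Real.exp (c * y)) := by
  rw [← hasSum_nat_add_iff' j]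
  have h0 : ∑ i ∈ Finset.range j,
      (((i.descFactorial j : ℝ) * c ^ (i - j)) * (y ^ i / i.factorial)) = 0 := by
    apply Finset.sum_eq_zero
    intro i hi
    rw [Nat.descFactorial_of_lt (Finset.mem_range.mp hi)]
    simp
  rw [h0, sub_zero]
  have h1 : HasSum (fun n : ℕ => (c * y) ^ n / n.factorial) (Real.exp (c * y)) := by
    rw [Real.exp_eq_exp_ℝ]
    exact NormedSpace.expSeries_div_hasSum_exp (c * y)
  have h2 := h1.mul_left (y ^ j)
  refine Eq.mpr (congrArg (fun g => HasSum g _) (funext fun n => ?_)) h2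
  have h3 : ((n + j).factorial : ℝ) = n.factorial * ((n + j).descFactorial j : ℝ) := by
    have := Nat.factorial_mul_descFactorial (Nat.le_add_left j n)
    rw [Nat.add_sub_cancel] at this
    exact_mod_cast this.symm
  have h4 : (n.factorial : ℝ) ≠ 0 := by positivity
  have h5 : ((n + j).descFactorial j : ℝ) ≠ 0 := by
    have : 0 < (n + j).descFactorial j := Nat.descFactorial_pos.mpr (by omega)
    positivity
  rw [h3, Nat.add_sub_cancel]
  field_simp
  ring

lemma P_nonneg (y : ℝ) (hy : 0 ≤ y) :
    0 ≤ Real.exp y * (Real.exp y - 1 - y) ^ 3 - (Real.exp y - 1) ^ 4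
      + y ^ 2 * Real.exp y * (Real.exp y - 1) ^ 2 := by
  have h3 : Real.exp (3 * y) = Real.exp y ^ 3 := by rw [← Real.exp_nat_mul]; norm_num
  have h2 : Real.exp (2 * y) = Real.exp y ^ 2 := by rw [← Real.exp_nat_mul]; norm_num
  have hs := ((((((((((hs_aux y 3 2).add ((hs_aux y 3 1).mul_left (-3))).add (hs_aux y 3 0)).add
    (hs_aux y 2 2)).add ((hs_aux y 2 1).mul_left 6)).add ((hs_aux y 2 0).mul_left (-3))).add
    ((hs_aux y 1 3).mul_left (-1))).add ((hs_aux y 1 2).mul_left (-2))).add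
    ((hs_aux y 1 1).mul_left (-3))).add ((hs_aux y 1 0).mul_left 3)).add
    ((hs_aux y 0 0).mul_left (-1))
  rw [h3, h2] at hs
  have := hs.nonneg (fun n => by
    have hw : 0 ≤ y ^ n / n.factorial := by positivity
    generalize y ^ n / n.factorial = w at hw
    by_cases hn : n < 9
    · interval_cases n <;> norm_num [Nat.descFactorial] <;> linarith
    · obtain ⟨m, rfl⟩ : ∃ m, n = m + 9 := ⟨n - 9, by omega⟩
      have e1 : m + 9 - 1 = m + 8 := by omega
      have e2 : m + 9 - 2 = m + 7 := by omega
      have e3 : m + 9 - 3 = m + 6 := by omega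
      simp only [Nat.descFactorial_succ, Nat.descFactorial_zero, e1, e2, e3, Nat.sub_zero, one_pow]
      push_cast
      have hA : (0 : ℝ) ≤ 3 ^ m := by positivity
      have hB : (m : ℝ) + 1 ≤ 2 ^ m := by
        have := Nat.lt_two_pow_self (n := m)
        exact_mod_cast this
      have hz : (0 : ℝ) ^ (m + 9) = 0 := by simp
      rw [hz]
      simp only [pow_add]
      generalize (3 : ℝ) ^ m = A at hA
      generalize (2 : ℝ) ^ m = B at hB
      have hm : (0 : ℝ) ≤ m := Nat.cast_nonneg m
      generalize (m : ℝ) = z at hm hB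
      have key : 0 ≤ (z + 8) * (2187 * A * z + 128 * B * (z + 21) - ((z + 9) ^ 2 + 3)) := by
        apply mul_nonneg (by linarith)
        have q1 : 0 ≤ A * z := by positivity
        have q2 : 0 ≤ (B - z - 1) * (z + 21) := mul_nonneg (by linarith) (by linarith)
        nlinarith
      have := mul_nonneg key hw
      linarith)
  refine this.trans (le_of_eq ?_)
  norm_num
  ring

lemma Q_nonneg (y : ℝ) (hy : 0 ≤ y) :
    0 ≤ (6 + y) * ((Real.exp y - 1) ^ 2 - y ^ 2 * Real.exp y)
      - y * (Real.exp y - 1) * (Real.exp y - 1 - y) := by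
  have h2 : Real.exp (2 * y) = Real.exp y ^ 2 := by rw [← Real.exp_nat_mul]; norm_num
  have hs := ((((((hs_aux y 2 0).mul_left 6).add ((hs_aux y 1 0).mul_left (-12))).add
    ((hs_aux y 1 2).mul_left (-5))).add ((hs_aux y 1 3).mul_left (-1))).add
    ((hs_aux y 0 0).mul_left 6)).add ((hs_aux y 0 2).mul_left (-1))
  rw [h2] at hs
  have := hs.nonneg (fun n => by
    have hw : 0 ≤ y ^ n / n.factorial := by positivity
    generalize y ^ n / n.factorial = w at hw
    by_cases hn : n < 5
    · interval_cases n <;> norm_num [Nat.descFactorial] <;> linarith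
    · obtain ⟨m, rfl⟩ : ∃ m, n = m + 5 := ⟨n - 5, by omega⟩
      have e1 : m + 5 - 1 = m + 4 := by omega
      have e2 : m + 5 - 2 = m + 3 := by omega
      simp only [Nat.descFactorial_succ, Nat.descFactorial_zero, e1, e2, Nat.sub_zero, one_pow]
      push_cast
      have hB : (m : ℝ) ^ 3 + 17 * m ^ 2 + 92 * m + 172 ≤ 192 * 2 ^ m := by
        clear hn e1 e2
        induction m with
        | zero => norm_num
        | succ m ih =>
          push_cast
          rw [pow_succ (2 : ℝ) m]
          have hm : (0 : ℝ) ≤ m := Nat.cast_nonneg m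
          nlinarith [pow_nonneg hm 3, pow_nonneg hm 2]
      have hz : (0 : ℝ) ^ (m + 5) = 0 := by simp
      have hz' : (0 : ℝ) ^ (m + 3) = 0 := by simp
      rw [hz, hz']
      simp only [pow_add]
      generalize (2 : ℝ) ^ m = B at hB
      have hm : (0 : ℝ) ≤ m := Nat.cast_nonneg m
      generalize (m : ℝ) = z at hm hB
      have key : 0 ≤ 192 * B - 12 - 5 * ((z + 5) * (z + 4)) - (z + 5) * (z + 4) * (z + 3) := by
        nlinarith
      have := mul_nonneg key hw
      linarith)
  refine this.trans (le_of_eq ?_)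
  norm_num
  ring

lemma D_pos {y : ℝ} (hy : y ≠ 0) : 0 < Real.exp y - 1 - y := by
  have := Real.add_one_lt_exp hy
  linarith

noncomputable def psd (y : ℝ) : ℝ :=
  ((Real.exp y - 1) ^ 2 - y ^ 2 * Real.exp y) / (Real.exp y - 1 - y) ^ 2

lemma psi_deriv {y : ℝ} (hy : 0 < y) : HasDerivAt psi (psd y) y := by
  have hD := D_pos hy.ne'
  have h1 : HasDerivAt (fun x : ℝ => x * (Real.exp x - 1) / (Real.exp x - 1 - x))
      (((1 * (Real.exp y - 1) + y * Real.exp y) * (Real.exp y - 1 - y)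
        - y * (Real.exp y - 1) * (Real.exp y - 1)) / (Real.exp y - 1 - y) ^ 2) y :=
    ((hasDerivAt_id y).mul ((Real.hasDerivAt_exp y).sub_const 1)).div
      (((Real.hasDerivAt_exp y).sub_const 1).sub (hasDerivAt_id y)) hD.ne'
  have h2 : HasDerivAt (fun x : ℝ => x * (Real.exp x - 1) / (Real.exp x - 1 - x)) (psd y) y := by
    convert h1 using 1
    unfold psd
    congr 1
    ring
  refine h2.congr_of_eventuallyEq ?_
  filter_upwards [lt_mem_nhds hy] with z hz
  simp [psi, hz.ne']

lemma psi_eq {y : ℝ} (hy : 0 < y) :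
    psi y = y * (Real.exp y - 1) / (Real.exp y - 1 - y) := by simp [psi, hy.ne']

lemma psi_pos {y : ℝ} (hy : 0 < y) : 0 < psi y := by
  have hD := D_pos hy.ne'
  have : 0 < Real.exp y - 1 := by linarith
  rw [psi_eq hy]
  positivity

noncomputable def Ef (y : ℝ) : ℝ :=
  1 + y * Real.exp y / (Real.exp y - 1) - y * (Real.exp y - 1) / (Real.exp y - 1 - y)

lemma Ef_eq {y : ℝ} (hy : 0 < y) : Ef y * psi y = y * psd y := by
  have hD := D_pos hy.ne'
  have h1 : 0 < Real.exp y - 1 := by linarith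
  rw [psi_eq hy, Ef, psd]
  have := hD.ne'
  have := h1.ne'
  field_simp
  ring

lemma Ef_mono : MonotoneOn Ef (Set.Ioi 0) := by
  have hd : ∀ y ∈ Set.Ioi (0 : ℝ), HasDerivAt Ef
      (((1 * Real.exp y + y * Real.exp y) * (Real.exp y - 1) - y * Real.exp y * Real.exp y)
        / (Real.exp y - 1) ^ 2 -
      ((1 * (Real.exp y - 1) + y * Real.exp y) * (Real.exp y - 1 - y)
        - y * (Real.exp y - 1) * (Real.exp y - 1)) / (Real.exp y - 1 - y) ^ 2) y := by
    intro y hy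
    have hy : 0 < y := hy
    have hD := D_pos hy.ne'
    have h1 : 0 < Real.exp y - 1 := by linarith
    exact ((((hasDerivAt_id y).mul (Real.hasDerivAt_exp y)).div
      ((Real.hasDerivAt_exp y).sub_const 1) h1.ne').const_add 1).sub
      (((hasDerivAt_id y).mul ((Real.hasDerivAt_exp y).sub_const 1)).div
      (((Real.hasDerivAt_exp y).sub_const 1).sub (hasDerivAt_id y)) hD.ne')
  apply monotoneOn_of_deriv_nonneg (convex_Ioi 0)
  · exact fun y hy => (hd y hy).continuousAt.continuousWithinAt
  · rw [interior_Ioi]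
    exact fun y hy => (hd y hy).differentiableAt.differentiableWithinAt
  · rw [interior_Ioi]
    intro y hy
    rw [(hd y hy).deriv]
    have hy : 0 < y := hy
    have hD := D_pos hy.ne'
    have h1 : 0 < Real.exp y - 1 := by linarith
    rw [div_sub_div _ _ (by positivity) (by positivity)]
    apply div_nonneg _ (by positivity)
    have := P_nonneg y hy.le
    linarith

lemma psd_lower {y : ℝ} (hy : 0 < y) : psi y / (6 + y) ≤ psd y := by
  have hD := D_pos hy.ne'
  have h1 : 0 < Real.exp y - 1 := by linarith
  rw [psi_eq hy, psd, div_div, div_le_div_iff₀ (by positivity) (by positivity)]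
  have := mul_nonneg (Q_nonneg y hy.le) hD.le
  nlinarith

lemma psd_pos {y : ℝ} (hy : 0 < y) : 0 < psd y :=
  lt_of_lt_of_le (div_pos (psi_pos hy) (by linarith)) (psd_lower hy)

lemma fEx_deriv (y : ℝ) : HasDerivAt fEx (Real.exp y - 1) y :=
  ((Real.hasDerivAt_exp y).sub_const 1).sub (hasDerivAt_id y)

lemma log_ineq {y l : ℝ} (hy : 0 < y) (hl : y ≤ l) :
    psi l * (psi l - psi y) ≤ l * psd l * (Real.log (fEx l) - Real.log (fEx y)) := by
  have hl0 : 0 < l := by linarith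
  have hd : ∀ z ∈ Set.Ioi (0 : ℝ), HasDerivAt
      (fun z => l * psd l * Real.log (fEx z) - psi l * psi z)
      (l * psd l * ((Real.exp z - 1) / fEx z) - psi l * psd z) z := by
    intro z hz
    have hz : 0 < z := hz
    exact (((fEx_deriv z).log (D_pos hz.ne').ne').const_mul _).sub ((psi_deriv hz).const_mul _)
  have hm : MonotoneOn (fun z => l * psd l * Real.log (fEx z) - psi l * psi z) (Set.Ioc 0 l) := by
    apply monotoneOn_of_deriv_nonneg (convex_Ioc 0 l)
    · exact fun y hy => (hd y hy.1).continuousAt.continuousWithinAt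
    · rw [interior_Ioc]
      exact fun y hy => (hd y hy.1).differentiableAt.differentiableWithinAt
    · rw [interior_Ioc]
      intro z hz
      rw [(hd z hz.1).deriv]
      have hz0 : 0 < z := hz.1
      have hE := Ef_mono (Set.mem_Ioi.mpr hz0) (Set.mem_Ioi.mpr hl0) hz.2.le
      have e1 : (Real.exp z - 1) / fEx z = psi z / z := by
        rw [psi_eq hz0, fEx]
        field_simp
      have e2 : psd z = Ef z * psi z / z := by rw [Ef_eq hz0]; field_simp
      rw [e1, e2, ← Ef_eq hl0]
      have : Ef l * psi l * (psi z / z) - psi l * (Ef z * psi z / z)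
        = (Ef l - Ef z) * (psi l * psi z / z) := by ring
      rw [this]
      have := psi_pos hz0
      have := psi_pos hl0
      exact mul_nonneg (by linarith) (by positivity)
  have := hm ⟨hy, hl⟩ ⟨hl0, le_rfl⟩ hl
  simp only at this
  linarith

lemma ent_ineq {R : ℝ} (h0 : 0 < R) (h1 : R ≤ 1) :
    (1 - R) ^ 2 / 8 ≤ Real.log 2 - Real.log (1 + R) + R / (1 + R) * Real.log R := by
  have hd : ∀ z ∈ Set.Ioi (0 : ℝ), HasDerivAt
      (fun z => Real.log 2 - Real.log (1 + z) + z / (1 + z) * Real.log z - (1 - z) ^ 2 / 8)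
      (0 - 1 / (1 + z) + ((1 * (1 + z) - z * 1) / (1 + z) ^ 2 * Real.log z + z / (1 + z) * z⁻¹)
        - (((2 : ℕ) * (1 - z) ^ (2 - 1) * (-1)) / 8)) z := by
    intro z hz
    have hz : 0 < z := hz
    have hp : HasDerivAt (fun z : ℝ => 1 + z) 1 z := (hasDerivAt_id z).const_add 1
    have hq : HasDerivAt (fun z : ℝ => 1 - z) (-1) z := (hasDerivAt_id z).const_sub 1
    exact (((hasDerivAt_const z _).sub (hp.log (by positivity))).add
      (((hasDerivAt_id z).div hp (by positivity)).mul (Real.hasDerivAt_log hz.ne'))).sub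
      ((hq.pow 2).div_const 8)
  have hm : AntitoneOn (fun z => Real.log 2 - Real.log (1 + z) + z / (1 + z) * Real.log z
      - (1 - z) ^ 2 / 8) (Set.Ioc 0 1) := by
    apply antitoneOn_of_deriv_nonpos (convex_Ioc 0 1)
    · exact fun y hy => (hd y hy.1).continuousAt.continuousWithinAt
    · rw [interior_Ioc]
      exact fun y hy => (hd y hy.1).differentiableAt.differentiableWithinAt
    · rw [interior_Ioc]
      intro z hz
      rw [(hd z hz.1).deriv]
      have hz0 : 0 < z := hz.1
      have hz1 : z < 1 := hz.2
      have hl := Real.log_le_sub_one_of_pos hz0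
      have e : 0 - 1 / (1 + z) + ((1 * (1 + z) - z * 1) / (1 + z) ^ 2 * Real.log z
          + z / (1 + z) * z⁻¹) - ((((2 : ℕ) : ℝ) * (1 - z) ^ (2 - 1) * (-1)) / 8)
          = Real.log z / (1 + z) ^ 2 + (1 - z) / 4 := by
        push_cast
        field_simp
        ring
      rw [e]
      have : Real.log z / (1 + z) ^ 2 ≤ -(1 - z) / 4 := by
        rw [div_le_div_iff₀ (by positivity) (by norm_num)]
        nlinarith [mul_nonneg (mul_nonneg (sub_nonneg.mpr hz1.le) (sub_nonneg.mpr hz1.le)) (by linarith : 0 ≤ 3 + z)]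
      linarith
  have := hm ⟨h0, h1⟩ ⟨one_pos, le_rfl⟩ h1
  norm_num at this
  have e : Real.log (1 + 1) = Real.log 2 := by norm_num
  linarith

lemma fEx_conv {l x : ℝ} (hx0 : 0 ≤ x) (hx1 : x ≤ 1) : fEx (l * x) ≤ x * fEx l := by
  have := convexOn_exp.2 (Set.mem_univ l) (Set.mem_univ 0) hx0 (sub_nonneg.mpr hx1) (by ring)
  simp only [smul_eq_mul, mul_zero, add_zero, Real.exp_zero, mul_one] at this
  unfold fEx
  rw [mul_comm l x]
  linarith

/-- main analytic bound -/
lemma main_bound {l x h : ℝ} (hl : 0 < l) (hx0 : 0 ≤ x) (hx1 : x < 1)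
    (hh : 0 ≤ psi l * h + Real.log ((1 + fEx (l * x) / fEx l) / 2)) :
    (1 - x) ^ 2 / 8 / (6 + l) ≤ psd l * h +
      ((Real.exp (l * x) - 1) * x * fEx l - fEx (l * x) * (Real.exp l - 1)) / fEx l ^ 2 / 2 /
        ((1 + fEx (l * x) / fEx l) / 2) := by
  have hf : 0 < fEx l := D_pos hl.ne'
  have hps := psi_pos hl
  have hpd := psd_pos hl
  have hlow := psd_lower hl
  have hK : ∀ K : ℝ, (1 - x) ^ 2 / 8 ≤ K → (1 - x) ^ 2 / 8 / (6 + l) ≤ psd l / psi l * K := by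
    intro K hK
    have : 1 / (6 + l) ≤ psd l / psi l := by
      rw [le_div_iff₀ hps]
      calc 1 / (6 + l) * psi l = psi l / (6 + l) := by ring
        _ ≤ _ := hlow
    calc (1 - x) ^ 2 / 8 / (6 + l) = 1 / (6 + l) * ((1 - x) ^ 2 / 8) := by ring
      _ ≤ psd l / psi l * K := mul_le_mul this hK (by positivity) (by positivity)
  have hR0 : 0 ≤ fEx (l * x) / fEx l := by
    apply div_nonneg _ hf.le
    unfold fEx
    have := Real.add_one_le_exp (l * x)
    linarith
  have hRx : fEx (l * x) / fEx l ≤ x := by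
    rw [div_le_iff₀ hf]
    exact fEx_conv hx0 hx1.le
  rw [Real.log_div (by positivity) (by norm_num)] at hh
  rcases hx0.eq_or_lt with rfl | hx
  · have e : fEx (l * 0) = 0 := by simp [fEx]
    rw [e] at hh ⊢
    simp only [zero_div, add_zero, Real.log_one, mul_zero, zero_mul, sub_zero] at hh ⊢
    have h2 : (1 - 0 : ℝ) ^ 2 / 8 ≤ Real.log 2 := by
      have := Real.log_two_gt_d9
      linarith
    have := hK _ h2
    rw [sub_zero] at this
    refine this.trans ?_
    rw [div_mul_eq_mul_div, div_le_iff₀ hps]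
    nlinarith
  · have hy : 0 < l * x := by positivity
    have hfy : 0 < fEx (l * x) := D_pos hy.ne'
    have hli := log_ineq hy (by nlinarith : l * x ≤ l)
    have hlog : Real.log (fEx (l * x) / fEx l) = Real.log (fEx (l * x)) - Real.log (fEx l) :=
      Real.log_div hfy.ne' hf.ne'
    have hent := ent_ineq (div_pos hfy hf) (by linarith : fEx (l * x) / fEx l ≤ 1)
    have hsq : (1 - x) ^ 2 / 8 ≤ (1 - fEx (l * x) / fEx l) ^ 2 / 8 := by
      have : (1 - x) ^ 2 ≤ (1 - fEx (l * x) / fEx l) ^ 2 :=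
        pow_le_pow_left₀ (by linarith) (by linarith) 2
      linarith
    have h1 := hK _ (hsq.trans hent)
    refine h1.trans ?_
    rw [hlog]
    set R := fEx (l * x) / fEx l with hR
    set T := Real.log (fEx l) - Real.log (fEx (l * x)) with hT
    have e : ((Real.exp (l * x) - 1) * x * fEx l - fEx (l * x) * (Real.exp l - 1)) / fEx l ^ 2 / 2 /
        ((1 + R) / 2) = - (R / (1 + R) * ((psi l - psi (l * x)) / l)) := by
      have p1 : psi l = l * (Real.exp l - 1) / fEx l := psi_eq hl
      have p2 : psi (l * x) = l * x * (Real.exp (l * x) - 1) / fEx (l * x) := psi_eq hy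
      have hR1 : 1 + R ≠ 0 := by positivity
      rw [p1, p2]
      have hfe : fEx (l * x) = R * fEx l := by rw [hR]; field_simp
      have hRp : R ≠ 0 := (div_pos hfy hf).ne'
      rw [hfe]
      field_simp
      ring
    rw [e]
    have hc : (psi l - psi (l * x)) / l ≤ psd l / psi l * T := by
      rw [div_mul_eq_mul_div, div_le_div_iff₀ hl hps]
      linarith
    have hp : 0 ≤ R / (1 + R) := by positivity
    have h2 := mul_le_mul_of_nonneg_left hc hp
    have h3 : psd l / psi l * (Real.log 2 - Real.log (1 + R)) ≤ psd l * h := by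
      rw [div_mul_eq_mul_div, div_le_iff₀ hps]
      nlinarith
    have e2 : Real.log (fEx (l * x)) - Real.log (fEx l) = -T := by rw [hT]; ring
    rw [e2]
    linarith

lemma Hk_deriv (k : ℕ) (a l : ℝ) (hl : 0 < l) (hx0 : 0 ≤ 1 - 2 * a) :
    HasDerivAt (fun t => HkAl k a t) (psd l * (Hent a / k) +
      ((Real.exp (l * (1 - 2 * a)) - 1) * (1 - 2 * a) * fEx l
        - fEx (l * (1 - 2 * a)) * (Real.exp l - 1)) / fEx l ^ 2 / 2 /
        ((1 + fEx (l * (1 - 2 * a)) / fEx l) / 2)) l := by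
  have hf : 0 < fEx l := D_pos hl.ne'
  have hR0 : 0 ≤ fEx (l * (1 - 2 * a)) / fEx l := by
    apply div_nonneg _ hf.le
    unfold fEx
    have := Real.add_one_le_exp (l * (1 - 2 * a))
    linarith
  have h1 : HasDerivAt (fun t => fEx (t * (1 - 2 * a)))
      ((Real.exp (l * (1 - 2 * a)) - 1) * (1 - 2 * a)) l := by
    have := (fEx_deriv (l * (1 - 2 * a))).comp l ((hasDerivAt_id l).mul_const (1 - 2 * a))
    simpa [Function.comp_def] using this
  have h2 := (((h1.div (fEx_deriv l) hf.ne').const_add 1).div_const 2).log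
    (by simp only [Pi.div_apply]; positivity)
  have h3 : HasDerivAt (fun t => HkAl k a t) _ l := (((psi_deriv hl).div_const (k : ℝ)).mul_const (Hent a)).add h2
  refine h3.congr_deriv ?_
  simp only [Pi.div_apply]
  ring

lemma alpha_le (k : ℕ) (hk : 4 ≤ k) : 0 < alphaK k ∧ alphaK k ≤ 0.68 := by
  have hk' : (4 : ℝ) ≤ k := by exact_mod_cast hk
  refine ⟨by unfold alphaK; positivity, ?_⟩
  have h1 : (k : ℝ) ^ (-(k : ℝ) / ((k : ℝ) - 2)) ≤ (k : ℝ) ^ (-1 : ℝ) := by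
    apply Real.rpow_le_rpow_of_exponent_le (by linarith)
    rw [div_le_iff₀ (by linarith)]
    linarith
  rw [Real.rpow_neg_one] at h1
  have h2 : (k : ℝ)⁻¹ ≤ 4⁻¹ := inv_anti₀ (by norm_num) hk'
  have h3 := Real.exp_one_lt_d9
  unfold alphaK
  calc _ ≤ Real.exp 1 * 4⁻¹ := mul_le_mul_of_nonneg_left (h1.trans h2) (by positivity)
    _ ≤ _ := by linarith

lemma exp_low (k : ℕ) (hk : 4 ≤ k) : 3 * (6 + (k : ℝ)) ≤ 1 + Real.exp k := by
  have hk' : (4 : ℝ) ≤ k := by exact_mod_cast hk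
  have h := Real.sum_le_exp_of_nonneg (by linarith : (0 : ℝ) ≤ k) 5
  simp [Finset.sum_range_succ, Nat.factorial] at h
  generalize (k : ℝ) = z at *
  have a2 : 16 ≤ z ^ 2 := by nlinarith
  have a3 : 64 ≤ z ^ 3 := by nlinarith
  have a4 : 256 ≤ z ^ 4 := by nlinarith
  nlinarith

theorem Hk_monotone_in_lambda (k : ℕ) (hk : 4 ≤ k)
    (lamk : ℝ) (hlamk : 0 < lamk) (hroot : psi lamk = k) :
    ∀ a : ℝ, 0.99 * alphaK k ≤ a → a ≤ 1 / 2 →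
    ∀ lam : ℝ, 0 < lam → lam ≤ lamk →
    0 ≤ HkAl k a lam →
    1.7 * (alphaK k) ^ 3 / (1 + Real.exp k) ≤ deriv (fun t => HkAl k a t) lam := by
  intro a ha1 ha2 l hl hlk hH
  obtain ⟨hα0, hα1⟩ := alpha_le k hk
  have hk' : (4 : ℝ) ≤ k := by exact_mod_cast hk
  have ha0 : 0 < a := by linarith
  have hlamk' : lamk ≤ k := by
    rw [← hroot, psi_eq hlamk, le_div_iff₀ (D_pos hlamk.ne')]
    apply mul_le_mul_of_nonneg_left _ hlamk.le
    linarith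
  rw [(Hk_deriv k a l hl (by linarith)).deriv]
  have hh : 0 ≤ psi l * (Hent a / k) + Real.log ((1 + fEx (l * (1 - 2 * a)) / fEx l) / 2) := by
    refine hH.trans (le_of_eq ?_)
    unfold HkAl
    ring
  refine le_trans ?_ (main_bound hl (by linarith) (by linarith) hh)
  have he := exp_low k hk
  have hek := Real.exp_pos (k : ℝ)
  generalize alphaK k = A at *
  have h1 : (0.99 * A) ^ 2 ≤ a ^ 2 := pow_le_pow_left₀ (by linarith) ha1 2
  have h2 : A ^ 2 * 0.49 / (6 + k) ≤ (1 - (1 - 2 * a)) ^ 2 / 8 / (6 + l) := by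
    apply div_le_div₀ (by positivity) _ (by linarith) (by linarith)
    nlinarith [sq_nonneg A]
  refine le_trans ?_ h2
  rw [div_le_div_iff₀ (by linarith) (by linarith)]
  have h3 : 1.7 * A * (6 + k) ≤ 0.49 * (1 + Real.exp k) := by nlinarith
  nlinarith [mul_le_mul_of_nonneg_left h3 (sq_nonneg A)]
end

section
/- Fix an integer k ≥ 4, set α_k = e·k^{−k/(k−2)}, and let λ_k be the unique positive root of ψ(λ) = k. Then for every α ∈ [0.99·α_k, 1/2], H(α) + ln[(f(λ_k) + f(λ_k(1 − 2α))) / (2 f(λ_k))] ≤ 0, with equality at α = 1/2. -/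
lemma fEx_nonneg (x : ℝ) : 0 ≤ fEx x := by
  unfold fEx; linarith [Real.add_one_le_exp x]

lemma fEx_pos {x : ℝ} (hx : 0 < x) : 0 < fEx x := by
  unfold fEx; linarith [Real.add_one_lt_exp hx.ne']

lemma exp_lower (x : ℝ) (hx : 0 ≤ x) (n : ℕ) :
    ∑ i ∈ Finset.range n, x ^ i / (Nat.factorial i : ℝ) ≤ Real.exp x :=
  Real.sum_le_exp_of_nonneg hx n

lemma exp_upper (x : ℝ) (hx : 0 ≤ x) (hx4 : x ≤ 4) :
    Real.exp x ≤ (∑ i ∈ Finset.range 7, (x / 4) ^ i / (Nat.factorial i : ℝ) +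
      (x / 4) ^ 7 * (7 + 1) / ((Nat.factorial 7 : ℝ) * 7)) ^ 4 := by
  have h := Real.exp_bound' (x := x / 4) (by linarith) (by linarith) (n := 7) (by norm_num)
  have e : Real.exp x = Real.exp (x / 4) ^ 4 := by
    rw [← Real.exp_nat_mul]; congr 1; push_cast; ring
  rw [e]
  exact pow_le_pow_left₀ (Real.exp_pos _).le (by exact_mod_cast h) 4

/-- scaling: `f(s x) ≤ s^2 f(x)`. -/
lemma fEx_scale {s x : ℝ} (hs0 : 0 ≤ s) (hs1 : s ≤ 1) (hx : 0 ≤ x) :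
    fEx (s * x) ≤ s ^ 2 * fEx x := by
  have hm : MonotoneOn (fun x : ℝ => s ^ 2 * fEx x - fEx (s * x)) (Set.Ici 0) := by
    have hd : ∀ x : ℝ, HasDerivAt (fun x : ℝ => s ^ 2 * fEx x - fEx (s * x))
        (s ^ 2 * (Real.exp x - 1) - (Real.exp (s * x) * s - s)) x := by
      intro x
      have h1 : HasDerivAt (fun x : ℝ => fEx x) (Real.exp x - 1) x := by
        unfold fEx
        exact ((Real.hasDerivAt_exp x).sub_const 1).sub (hasDerivAt_id x)
      have h3 : HasDerivAt (fun x : ℝ => s * x) s x := by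
        simpa using (hasDerivAt_id x).const_mul s
      have h2 : HasDerivAt (fun x : ℝ => fEx (s * x)) (Real.exp (s * x) * s - s) x := by
        unfold fEx
        exact ((h3.exp).sub_const 1).sub h3
      exact (h1.const_mul (s ^ 2)).sub h2
    apply monotoneOn_of_deriv_nonneg (convex_Ici 0)
    · exact fun x _ => (hd x).continuousAt.continuousWithinAt
    · exact fun x _ => (hd x).differentiableAt.differentiableWithinAt
    · intro x _
      rw [(hd x).deriv]
      have hc := convexOn_exp.2 (Set.mem_univ x) (Set.mem_univ (0:ℝ)) hs0
        (sub_nonneg.2 hs1) (by ring)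
      simp only [smul_eq_mul, mul_zero, add_zero, Real.exp_zero, mul_one] at hc
      nlinarith
  have := hm (Set.mem_Ici.2 le_rfl) (Set.mem_Ici.2 hx) hx
  simp only [mul_zero] at this
  have h0 : fEx 0 = 0 := by simp [fEx]
  rw [h0] at this
  linarith

lemma fEx_scale' {x y : ℝ} (hx : 0 ≤ x) (hxy : x ≤ y) (hy : 0 < y) :
    fEx x * y ^ 2 ≤ x ^ 2 * fEx y := by
  have h := fEx_scale (s := x / y) (x := y) (by positivity) ((div_le_one hy).2 hxy) hy.le
  rw [div_mul_cancel₀ _ hy.ne', div_pow, div_mul_eq_mul_div, le_div_iff₀ (by positivity)] at h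
  exact h

lemma fEx_exp {x y : ℝ} (hy : 0 ≤ y) (hyx : y ≤ x) :
    fEx y * Real.exp (x - y) ≤ fEx x := by
  unfold fEx
  have h1 := Real.add_one_le_exp (x - y)
  have h2 : Real.exp x = Real.exp y * Real.exp (x - y) := by
    rw [← Real.exp_add]; congr 1; ring
  rw [h2]
  nlinarith [mul_nonneg hy (sub_nonneg.2 hyx)]

lemma log_bound {y : ℝ} (hy : 0 ≤ y) :
    Real.log (1 + y) ≤ y - y ^ 2 / 2 + y ^ 3 / 3 := by
  have hd : ∀ x : ℝ, 0 ≤ x → HasDerivAt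
      (fun y : ℝ => y - y ^ 2 / 2 + y ^ 3 / 3 - Real.log (1 + y))
      (1 - x + x ^ 2 - 1 / (1 + x)) x := by
    intro x hx
    have h1 : HasDerivAt (fun y : ℝ => 1 + y) 1 x := (hasDerivAt_id x).const_add 1
    have h2 := h1.log (by positivity)
    have h3 := (((hasDerivAt_id x).sub ((hasDerivAt_pow 2 x).div_const 2)).add
      ((hasDerivAt_pow 3 x).div_const 3)).sub h2
    refine HasDerivAt.congr_deriv h3 ?_
    norm_num
    try ring
  have hm : MonotoneOn (fun y : ℝ => y - y ^ 2 / 2 + y ^ 3 / 3 - Real.log (1 + y))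
      (Set.Ici 0) := by
    apply monotoneOn_of_deriv_nonneg (convex_Ici 0)
    · exact fun x hx => (hd x hx).continuousAt.continuousWithinAt
    · intro x hx
      rw [interior_Ici] at hx
      exact (hd x (le_of_lt hx)).differentiableAt.differentiableWithinAt
    · intro x hx
      rw [interior_Ici] at hx
      have hx' : 0 < x := hx
      rw [(hd x hx'.le).deriv, sub_nonneg, div_le_iff₀ (by positivity)]
      nlinarith [pow_pos hx' 3]
  have := hm (Set.mem_Ici.2 le_rfl) (Set.mem_Ici.2 hy) hy
  norm_num at this
  linarith

lemma ent_bound {d : ℝ} (hd0 : 0 ≤ d) (hd1 : d < 1) :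
    d ^ 2 + d ^ 4 / 6 ≤ (1 + d) * Real.log (1 + d) + (1 - d) * Real.log (1 - d) := by
  have hd : ∀ x : ℝ, 0 ≤ x → x < 1 → HasDerivAt
      (fun d : ℝ => (1 + d) * Real.log (1 + d) + (1 - d) * Real.log (1 - d) - (d ^ 2 + d ^ 4 / 6))
      (Real.log (1 + x) - Real.log (1 - x) - (2 * x + 2 * x ^ 3 / 3)) x := by
    intro x hx hx1
    have a1 : (1 + x) ≠ 0 := by positivity
    have a2 : (1 - x) ≠ 0 := by linarith
    have h1 : HasDerivAt (fun y : ℝ => 1 + y) 1 x := (hasDerivAt_id x).const_add 1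
    have h2 : HasDerivAt (fun y : ℝ => 1 - y) (-1) x := (hasDerivAt_id x).const_sub 1
    have h3 := ((h1.mul (h1.log a1)).add (h2.mul (h2.log a2))).sub
      ((hasDerivAt_pow 2 x).add ((hasDerivAt_pow 4 x).div_const 6))
    refine HasDerivAt.congr_deriv h3 ?_
    simp only [mul_one_div, mul_div_assoc]
    field_simp
    norm_num
    ring
  have hm : MonotoneOn
      (fun d : ℝ => (1 + d) * Real.log (1 + d) + (1 - d) * Real.log (1 - d) - (d ^ 2 + d ^ 4 / 6))
      (Set.Ico 0 1) := by
    apply monotoneOn_of_deriv_nonneg (convex_Ico 0 1)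
    · exact fun x hx => (hd x hx.1 hx.2).continuousAt.continuousWithinAt
    · intro x hx
      rw [interior_Ico] at hx
      exact (hd x hx.1.le hx.2).differentiableAt.differentiableWithinAt
    · intro x hx
      rw [interior_Ico] at hx
      rw [(hd x hx.1.le hx.2).deriv]
      have hs := Real.hasSum_log_sub_log_of_abs_lt_one (x := x) (abs_lt.2 ⟨by linarith [hx.1], hx.2⟩)
      have h0 := hx.1
      have := sum_le_hasSum (Finset.range 2) (fun i _ => by positivity) hs
      norm_num [Finset.sum_range_succ] at this
      linarith
  have := hm (Set.mem_Ico.2 ⟨le_rfl, by norm_num⟩) (Set.mem_Ico.2 ⟨hd0, hd1⟩) hd0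
  norm_num at this
  linarith

lemma core {L a y : ℝ} (hL : 0 < L) (ha : 0 < a) (ha2 : a ≤ 1 / 2)
    (h : fEx (L * (1 - 2 * a)) ≤ y * fEx L)
    (hy : Real.log (1 + y) ≤ (1 - 2 * a) ^ 2 / 2 + (1 - 2 * a) ^ 4 / 12) :
    Hent a + Real.log ((fEx L + fEx (L * (1 - 2 * a))) / (2 * fEx L)) ≤ 0 := by
  have hF := fEx_pos hL
  have hf := fEx_nonneg (L * (1 - 2 * a))
  have hy0 : 0 ≤ y := by
    by_contra hc
    push Not at hc
    nlinarith
  have e := ent_bound (d := 1 - 2 * a) (by linarith) (by linarith)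
  have l1 : Real.log (1 + (1 - 2 * a)) = Real.log 2 + Real.log (1 - a) := by
    rw [← Real.log_mul (by norm_num) (by linarith)]; congr 1; ring
  have l2 : Real.log (1 - (1 - 2 * a)) = Real.log 2 + Real.log a := by
    rw [← Real.log_mul (by norm_num) (by linarith)]; congr 1; ring
  rw [l1, l2] at e
  have l3 : Real.log ((fEx L + fEx (L * (1 - 2 * a))) / (2 * fEx L)) ≤
      Real.log (1 + y) - Real.log 2 := by
    rw [← Real.log_div (by positivity) (by norm_num)]
    apply Real.log_le_log (by positivity)
    rw [div_le_div_iff₀ (by positivity) (by norm_num)]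
    nlinarith
  unfold Hent
  nlinarith

lemma root_eq {L k : ℝ} (hL : 0 < L) (h : psi L = k) : (k - L) * fEx L = L ^ 2 := by
  have hF := fEx_pos hL
  unfold psi at h
  rw [if_neg hL.ne'] at h
  have h2 : L * (Real.exp L - 1) / fEx L = k := h
  rw [div_eq_iff hF.ne'] at h2
  have : Real.exp L - 1 = fEx L + L := by unfold fEx; ring
  rw [this] at h2
  linarith

lemma fEx_quad {x : ℝ} (hx : 0 ≤ x) : x ^ 2 * (1 / 2 + x / 6 + x ^ 2 / 24) ≤ fEx x := by
  have := exp_lower x hx 5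
  norm_num [Finset.sum_range_succ, Nat.factorial] at this
  unfold fEx
  linarith

lemma it_low {L p q : ℝ} (hL : 0 < L) (h : (4 - L) * fEx L = L ^ 2) (hp : 0 < p) (hpL : p ≤ L)
    (hn : p ^ 2 ≤ (4 - q) * fEx p) : q ≤ L := by
  have h1 := fEx_scale' hp.le hpL hL
  have hF := fEx_pos hL
  have hf := fEx_pos hp
  have e : fEx p * (4 - L) ≤ p ^ 2 := by
    have h4 : 0 < 4 - L := by
      by_contra hc
      push Not at hc
      nlinarith
    have : fEx p * (4 - L) * fEx L ≤ p ^ 2 * fEx L := by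
      calc _ = fEx p * L ^ 2 := by rw [← h]; ring
        _ ≤ _ := h1
    exact le_of_mul_le_mul_right this hF
  have : fEx p * (4 - L) ≤ fEx p * (4 - q) := by linarith
  linarith [le_of_mul_le_mul_left this hf]

lemma it_up {L p q : ℝ} (hL : 0 < L) (h : (4 - L) * fEx L = L ^ 2) (hpL : L ≤ p)
    (hn : (4 - q) * fEx p ≤ p ^ 2) : L ≤ q := by
  have hp : 0 < p := hL.trans_le hpL
  have h1 := fEx_scale' hL.le hpL hp
  have hF := fEx_pos hL
  have hf := fEx_pos hp
  have e : p ^ 2 ≤ fEx p * (4 - L) := by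
    have : p ^ 2 * fEx L ≤ fEx p * (4 - L) * fEx L := by
      calc _ = fEx L * p ^ 2 := by ring
        _ ≤ _ := h1
        _ = _ := by rw [← h]; ring
    exact le_of_mul_le_mul_right this hF
  have : fEx p * (4 - q) ≤ fEx p * (4 - L) := by linarith
  linarith [le_of_mul_le_mul_left this hf]

lemma lam4 {L : ℝ} (hL : 0 < L) (h : (4 - L) * fEx L = L ^ 2) : 3.585 ≤ L ∧ L ≤ 3.598 := by
  have hF := fEx_pos hL
  have h4 : L < 4 := by
    by_contra hc
    push Not at hc
    nlinarith [pow_pos hL 2]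
  constructor
  · have h3 : 3 ≤ L := by
      by_contra hc
      push Not at hc
      have h1 := fEx_quad hL.le
      have h2 : L ^ 2 * ((4 - L) * (1 / 2 + L / 6 + L ^ 2 / 24)) ≤ L ^ 2 * 1 := by
        rw [mul_one]
        calc _ = (4 - L) * (L ^ 2 * (1 / 2 + L / 6 + L ^ 2 / 24)) := by ring
          _ ≤ (4 - L) * fEx L := by gcongr
          _ = _ := h
      have h3 := le_of_mul_le_mul_left h2 (by positivity)
      nlinarith [mul_pos hL (sub_pos.2 hc), mul_pos (mul_pos hL hL) (sub_pos.2 hc)]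
    have s1 : 3.44 ≤ L := it_low hL h (p := 3) (by norm_num) h3 (by
      have := exp_lower 3 (by norm_num) 16
      norm_num [Finset.sum_range_succ, Nat.factorial] at this
      unfold fEx; norm_num; linarith)
    have s2 : 3.5575 ≤ L := it_low hL h (p := 3.44) (by norm_num) s1 (by
      have := exp_lower 3.44 (by norm_num) 18
      norm_num [Finset.sum_range_succ, Nat.factorial] at this
      unfold fEx; norm_num; linarith)
    exact it_low hL h (p := 3.5575) (by norm_num) s2 (by
      have := exp_lower 3.5575 (by norm_num) 18
      norm_num [Finset.sum_range_succ, Nat.factorial] at this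
      unfold fEx; norm_num; linarith)
  · have s1 : L ≤ 3.678 := it_up hL h (p := 4) h4.le (by
      have := exp_upper 4 (by norm_num) (by norm_num)
      norm_num [Finset.sum_range_succ, Nat.factorial] at this
      unfold fEx; norm_num; linarith)
    have s2 : L ≤ 3.6125 := it_up hL h (p := 3.678) s1 (by
      have := exp_upper 3.678 (by norm_num) (by norm_num)
      norm_num [Finset.sum_range_succ, Nat.factorial] at this
      unfold fEx; norm_num; linarith)
    exact it_up hL h (p := 3.6125) s2 (by
      have := exp_upper 3.6125 (by norm_num) (by norm_num)
      norm_num [Finset.sum_range_succ, Nat.factorial] at this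
      unfold fEx; norm_num; linarith)

lemma seg {L d y c : ℝ} (hL : 0 < L) (h : (4 - L) * fEx L = L ^ 2) (hl : 3.585 ≤ L)
    (hd : 0 ≤ d) (hy : 0 < y) (hLy : L * d ≤ y) (hn : 0.415 * fEx y ≤ c * y ^ 2) :
    fEx (L * d) ≤ (c * d ^ 2) * fEx L := by
  have h1 := fEx_scale' (mul_nonneg hL.le hd) hLy hy
  have hF := fEx_pos hL
  have hf := fEx_pos hy
  have h2 : fEx (L * d) * y ^ 2 ≤ (c * d ^ 2) * fEx L * y ^ 2 := by
    calc _ ≤ (L * d) ^ 2 * fEx y := h1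
      _ = d ^ 2 * fEx L * ((4 - L) * fEx y) := by rw [mul_pow, ← h]; ring
      _ ≤ d ^ 2 * fEx L * (c * y ^ 2) := by
        apply mul_le_mul_of_nonneg_left _ (by positivity)
        refine le_trans ?_ hn
        apply mul_le_mul_of_nonneg_right _ hf.le
        norm_num at hl ⊢
        linarith
      _ = _ := by ring
  exact le_of_mul_le_mul_right h2 (by positivity)

lemma case4 {L a : ℝ} (hL : 0 < L) (h : (4 - L) * fEx L = L ^ 2)
    (ha : 0.16819 ≤ a) (ha2 : a ≤ 1 / 2) :
    Hent a + Real.log ((fEx L + fEx (L * (1 - 2 * a))) / (2 * fEx L)) ≤ 0 := by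
  obtain ⟨hl, hu⟩ := lam4 hL h
  norm_num at ha
  have ha0 : 0 < a := by linarith
  obtain ⟨d, hd⟩ : ∃ d, d = 1 - 2 * a := ⟨_, rfl⟩
  have hd0 : 0 ≤ d := by linarith
  have hdm : d ≤ 0.66365 := by norm_num; linarith
  rcases le_total d 0.55 with h5 | h5
  · refine core (y := 1 / 2 * (1 - 2 * a) ^ 2) hL ha0 ha2 ?_ ?_
    · rw [← hd]
      refine seg hL h hl hd0 (y := 1.98) (by norm_num) (by norm_num at *; nlinarith) ?_
      have := exp_upper 1.98 (by norm_num) (by norm_num)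
      norm_num [Finset.sum_range_succ, Nat.factorial] at this
      unfold fEx; norm_num; linarith
    · rw [← hd]
      have := Real.log_le_sub_one_of_pos (x := 1 + 1 / 2 * d ^ 2) (by positivity)
      have : 0 ≤ d ^ 4 := by positivity
      linarith
  · refine core (y := 0.55 * (1 - 2 * a) ^ 2) hL ha0 ha2 ?_ ?_
    · rw [← hd]
      refine seg hL h hl hd0 (y := 2.388) (by norm_num) (by norm_num at *; nlinarith) ?_
      have := exp_upper 2.388 (by norm_num) (by norm_num)
      norm_num [Finset.sum_range_succ, Nat.factorial] at this
      unfold fEx; norm_num; linarith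
    · rw [← hd]
      refine (log_bound (by positivity)).trans ?_
      obtain ⟨x, hx⟩ : ∃ x, x = d ^ 2 := ⟨_, rfl⟩
      have e4 : d ^ 4 = x ^ 2 := by rw [hx]; ring
      rw [e4, ← hx]
      have x1 : 0.3 ≤ x := by rw [hx]; norm_num at *; nlinarith
      have x2 : x ≤ 0.45 := by rw [hx]; norm_num at *; nlinarith
      have key : 0.05 - 0.55 ^ 2 / 2 * x + 0.55 ^ 3 / 3 * x ^ 2 - x / 12 ≤ 0 := by
        norm_num at *; nlinarith
      have x0 : 0 ≤ x := by norm_num at x1; linarith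
      have := mul_nonneg x0 (sub_nonneg.2 key)
      norm_num at *
      nlinarith

lemma alpha4 : (0.16819 : ℝ) ≤ 0.99 * alphaK 4 := by
  unfold alphaK
  have : ((4 : ℕ) : ℝ) ^ (-((4 : ℕ) : ℝ) / (((4 : ℕ) : ℝ) - 2)) = 1 / 16 := by
    have e : (-((4 : ℕ) : ℝ) / (((4 : ℕ) : ℝ) - 2)) = ((-2 : ℤ) : ℝ) := by norm_num
    rw [e, Real.rpow_intCast]; norm_num
  rw [this]
  have := Real.exp_one_gt_d9
  norm_num at *
  linarith

lemma alpha5 {k : ℕ} (hk : 5 ≤ k) : 0.88 / (k : ℝ) ≤ 0.99 * alphaK k := by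
  have hk' : (5 : ℝ) ≤ k := by exact_mod_cast hk
  have hk0 : (0 : ℝ) < k := by linarith
  have l5 : Real.log 5 ≤ 1.65 := by
    rw [Real.log_le_iff_le_exp (by norm_num)]
    have := exp_lower 1.65 (by norm_num) 8
    norm_num [Finset.sum_range_succ, Nat.factorial] at this
    norm_num; linarith
  have lk : Real.log k ≤ 0.65 + k / 5 := by
    have h1 := Real.log_le_sub_one_of_pos (x := (k : ℝ) / 5) (by positivity)
    rw [Real.log_div hk0.ne' (by norm_num)] at h1
    norm_num at *; linarith
  have l9 : (1 : ℝ) / 9 ≤ Real.log (9 / 8) := by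
    have := Real.one_sub_inv_le_log_of_pos (x := (9 : ℝ) / 8) (by norm_num)
    norm_num at *; linarith
  have e1 : (0.88 : ℝ) / k = 0.99 * Real.exp (-Real.log (9 / 8) - Real.log k) := by
    rw [Real.exp_sub, Real.exp_neg, Real.exp_log (by norm_num), Real.exp_log hk0]
    norm_num; ring
  rw [e1]
  unfold alphaK
  rw [Real.rpow_def_of_pos hk0, ← Real.exp_add]
  apply mul_le_mul_of_nonneg_left _ (by norm_num)
  apply Real.exp_le_exp.2
  have e2 : Real.log k * (-(k : ℝ) / (k - 2)) = - Real.log k - 2 * Real.log k / (k - 2) := by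
    have : (k : ℝ) - 2 ≠ 0 := by linarith
    field_simp; ring
  rw [e2]
  have : 2 * Real.log k / (k - 2) ≤ 10 / 9 := by
    rw [div_le_iff₀ (by linarith)]
    norm_num at lk; linarith
  linarith

lemma lam5 {L k : ℝ} (hk : 5 ≤ k) (hL : 0 < L) (h : (k - L) * fEx L = L ^ 2) :
    0.93 * k ≤ L := by
  have hF := fEx_pos hL
  have h1 := fEx_quad hL.le
  have h42 : 4.2 ≤ L := by
    by_contra hc
    push Not at hc
    have hc' : L < 21 / 5 := by norm_num at hc; exact hc
    have h2 : L ^ 2 * ((5 - L) * (1 / 2 + L / 6 + L ^ 2 / 24)) ≤ L ^ 2 * 1 := by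
      rw [mul_one]
      calc _ = (5 - L) * (L ^ 2 * (1 / 2 + L / 6 + L ^ 2 / 24)) := by ring
        _ ≤ (5 - L) * fEx L := by gcongr; linarith
        _ ≤ (k - L) * fEx L := by gcongr
        _ = _ := h
    have h3 := le_of_mul_le_mul_left h2 (by positivity)
    nlinarith [mul_pos hL (sub_pos.2 hc'), mul_pos (mul_pos hL hL) (sub_pos.2 hc')]
  by_contra hc
  push Not at hc
  have hs := fEx_scale' (x := 4.2) (y := L) (by norm_num) h42 hL
  have he := exp_lower 4.2 (by norm_num) 14
  norm_num [Finset.sum_range_succ, Nat.factorial] at he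
  have hf : 60 ≤ fEx 4.2 := by unfold fEx; norm_num; linarith
  have hs2 : 60 * L ^ 2 ≤ 4.2 ^ 2 * fEx L := by
    refine le_trans ?_ hs
    gcongr
  have e : (k - L) * 60 ≤ 4.2 ^ 2 := by
    have h5 : (k - L) * 60 * fEx L ≤ 4.2 ^ 2 * fEx L := by
      calc _ = 60 * L ^ 2 := by rw [← h]; ring
        _ ≤ _ := hs2
    exact le_of_mul_le_mul_right h5 hF
  norm_num at *
  linarith

lemma case5 {L a k : ℝ} (hk : 5 ≤ k) (hL : 0 < L) (h : (k - L) * fEx L = L ^ 2)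
    (ha : 0.88 / k ≤ a) (ha2 : a ≤ 1 / 2) :
    Hent a + Real.log ((fEx L + fEx (L * (1 - 2 * a))) / (2 * fEx L)) ≤ 0 := by
  have hl := lam5 hk hL h
  have hF := fEx_pos hL
  have hk0 : 0 < k := by linarith
  have ha0 : 0 < a := lt_of_lt_of_le (by positivity) ha
  obtain ⟨b, hb⟩ : ∃ b, b = 0.88 / k := ⟨_, rfl⟩
  have hbk : b * k = 0.88 := by rw [hb]; field_simp
  rw [← hb] at ha
  have hb0 : 0 < b := by rw [hb]; positivity
  have hb1 : b ≤ 0.176 := by rw [hb, div_le_iff₀ hk0]; norm_num; linarith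
  have hLb : 0.8184 ≤ L * b := by
    have := mul_le_mul_of_nonneg_right hl hb0.le
    norm_num at *; nlinarith
  norm_num at hb1
  have hD : 0 < 1 - 2 * b := by linarith
  have g1 := fEx_scale' (x := L * (1 - 2 * a)) (y := L * (1 - 2 * b))
    (mul_nonneg hL.le (by linarith)) (by gcongr) (by positivity)
  have g2 := fEx_exp (x := L) (y := L * (1 - 2 * b)) (by positivity) (by nlinarith)
  have g3 : 5 ≤ Real.exp (L - L * (1 - 2 * b)) := by
    have h6 : Real.exp 1.63 ≤ Real.exp (L - L * (1 - 2 * b)) := by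
      apply Real.exp_le_exp.2
      norm_num at *; linarith
    refine le_trans ?_ h6
    have := exp_lower 1.63 (by norm_num) 8
    norm_num [Finset.sum_range_succ, Nat.factorial] at this
    norm_num; linarith
  have g4 : 5 * fEx (L * (1 - 2 * b)) ≤ fEx L := by
    nlinarith [fEx_nonneg (L * (1 - 2 * b))]
  refine core (y := 1 / 2 * (1 - 2 * a) ^ 2) hL ha0 ha2 ?_ ?_
  · have hq : 2 / 5 ≤ (1 - 2 * b) ^ 2 := by nlinarith
    have hP : 0 < (L * (1 - 2 * b)) ^ 2 := by positivity
    refine le_of_mul_le_mul_right (le_trans g1 ?_) hP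
    calc (L * (1 - 2 * a)) ^ 2 * fEx (L * (1 - 2 * b))
        ≤ (L * (1 - 2 * a)) ^ 2 * (fEx L / 5) := by gcongr; linarith
      _ = 1 / 2 * (1 - 2 * a) ^ 2 * fEx L * L ^ 2 * (2 / 5) := by ring
      _ ≤ 1 / 2 * (1 - 2 * a) ^ 2 * fEx L * L ^ 2 * (1 - 2 * b) ^ 2 := by gcongr
      _ = _ := by ring
  · have := Real.log_le_sub_one_of_pos (x := 1 + 1 / 2 * (1 - 2 * a) ^ 2) (by positivity)
    have : 0 ≤ (1 - 2 * a) ^ 4 := by positivity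
    linarith

theorem Hk_extreme_case (k : ℕ) (hk : 4 ≤ k)
    (lamk : ℝ) (hlamk : 0 < lamk) (hroot : psi lamk = k) :
    (∀ a : ℝ, 0.99 * alphaK k ≤ a → a ≤ 1 / 2 →
      Hent a + Real.log ((fEx lamk + fEx (lamk * (1 - 2 * a))) / (2 * fEx lamk)) ≤ 0) ∧
    Hent (1 / 2) +
        Real.log ((fEx lamk + fEx (lamk * (1 - 2 * (1 / 2 : ℝ)))) / (2 * fEx lamk)) = 0 := by
  have h := root_eq hlamk hroot
  have hF := fEx_pos hlamk
  refine ⟨?_, ?_⟩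
  · intro a ha ha2
    rcases Nat.lt_or_ge k 5 with h5 | h5
    · obtain rfl : k = 4 := by omega
      exact case4 hlamk (by exact_mod_cast h) (alpha4.trans ha) ha2
    · exact case5 (by exact_mod_cast h5) hlamk h ((alpha5 h5).trans ha) ha2
  · have h0 : fEx (lamk * (1 - 2 * (1 / 2 : ℝ))) = 0 := by norm_num [fEx]
    have e : fEx lamk / (2 * fEx lamk) = 2⁻¹ := by field_simp
    have e2 : (1 : ℝ) - 2⁻¹ = 2⁻¹ := by norm_num
    rw [h0, add_zero, e]
    unfold Hent
    rw [one_div, e2, Real.log_inv]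
    ring
end

section
/- Fix an integer k ≥ 4 and a real c ∈ (2/k, 1). There exist ε > 0 and ζ₀ > 0 such that for every α ∈ (1/2, 1] there exists a pair ζ = (ζ₁, ζ₂) with ζ₁ > 0, ζ₂ ≥ ζ₀ and H_k(α, ζ; c) ≤ −ε. -/
/-- `H_k(α, (ζ₁,ζ₂); c)` with `λ` the positive root of `ψ(λ) = ck` passed explicitly. -/
noncomputable def HkF (k : ℕ) (a z1 z2 c lam : ℝ) : ℝ :=
  c * Hent a + c * k * a * Real.log (a / z1) + c * k * (1 - a) * Real.log ((1 - a) / z2)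
    + Real.log ((fEx (lam * (z2 + z1)) + fEx (lam * (z2 - z1))) / (2 * fEx lam))

lemma aux_fpos {x : ℝ} (hx : x ≠ 0) : 0 < fEx x := by
  unfold fEx
  have := Real.add_one_lt_exp hx
  linarith

lemma aux_f_neg {y : ℝ} (hy : 0 ≤ y) : fEx (-y) ≤ y ^ 2 / 2 := by
  unfold fEx
  have h1 := Real.quadratic_le_exp_of_nonneg hy
  have h2 : Real.exp (-y) * Real.exp y = 1 := by rw [← Real.exp_add]; simp
  have h3 := Real.exp_pos (-y)
  have h4 : Real.exp (-y) * (1 + y + y ^ 2 / 2) ≤ 1 := by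
    have := mul_le_mul_of_nonneg_left h1 h3.le
    linarith
  have h5 : 0 < 1 + y + y ^ 2 / 2 := by positivity
  have h6 : Real.exp (-y) ≤ 1 - y + y ^ 2 / 2 := by
    by_contra hcon
    push Not at hcon
    have := mul_lt_mul_of_pos_right hcon h5
    nlinarith [sq_nonneg (y ^ 2)]
  linarith

lemma aux_neglog {x : ℝ} (h0 : 0 < x) (h1 : x ≤ 1) :
    (1 - x) + (1 - x) ^ 2 / 2 + (1 - x) ^ 3 / 3 ≤ -Real.log x := by
  have h : |1 - x| < 1 := by rw [abs_lt]; constructor <;> linarith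
  have hs := Real.hasSum_pow_div_log_of_abs_lt_one h
  have h2 := sum_le_hasSum (Finset.range 3) (fun i _ => by
    have : 0 ≤ 1 - x := by linarith
    positivity) hs
  simp only [Finset.sum_range_succ, Finset.sum_range_zero] at h2
  norm_num at h2
  linarith

lemma aux_H_lower {a : ℝ} (h0 : 0 < a) (h1 : a < 1) : 8 / 3 * (a * (1 - a)) ≤ Hent a := by
  unfold Hent
  have h2 := mul_le_mul_of_nonneg_left (aux_neglog h0 h1.le) h0.le
  have h3 := mul_le_mul_of_nonneg_left (aux_neglog (x := 1 - a) (by linarith) (by linarith))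
    (show 0 ≤ 1 - a by linarith)
  have hb : 0 ≤ 1 - a := by linarith
  nlinarith [mul_nonneg (mul_nonneg h0.le hb) (sq_nonneg (a - (1 - a)))]

lemma aux_logdiff {x : ℝ} (h0 : 0 ≤ x) (h1 : x < 1) :
    2 * x ≤ Real.log (1 + x) - Real.log (1 - x) := by
  have h : |x| < 1 := by rw [abs_lt]; constructor <;> linarith
  have hs := Real.hasSum_log_sub_log_of_abs_lt_one h
  have h2 := sum_le_hasSum (Finset.range 1) (fun i _ => by positivity) hs
  simpa using h2

lemma aux_pinsker {x : ℝ} (h0 : 0 ≤ x) (h1 : x < 1) :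
    x ^ 2 ≤ (1 + x) * Real.log (1 + x) + (1 - x) * Real.log (1 - x) := by
  let g : ℝ → ℝ := fun x => (1 + x) * Real.log (1 + x) + (1 - x) * Real.log (1 - x) - x ^ 2
  have hd : ∀ y ∈ Set.Ico (0:ℝ) 1,
      HasDerivAt g (Real.log (1 + y) - Real.log (1 - y) - 2 * y) y := by
    intro y hy
    have hp : HasDerivAt (fun x : ℝ => 1 + x) 1 y := by
      simpa using (hasDerivAt_id y).const_add 1
    have hm : HasDerivAt (fun x : ℝ => 1 - x) (-1) y := by
      simpa using (hasDerivAt_id y).const_sub 1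
    have e1 : 1 + y ≠ 0 := by have := hy.1; positivity
    have e2 : 1 - y ≠ 0 := by have := hy.2; linarith
    have := ((hp.mul (hp.log e1)).add (hm.mul (hm.log e2))).sub (hasDerivAt_pow 2 y)
    refine HasDerivAt.congr_deriv this ?_
    rw [mul_div_cancel₀ _ e1, mul_div_cancel₀ _ e2]
    norm_num
    ring
  have hmono : MonotoneOn g (Set.Ico 0 1) := by
    apply monotoneOn_of_deriv_nonneg (convex_Ico 0 1)
    · exact fun y hy => (hd y hy).continuousAt.continuousWithinAt
    · intro y hy
      rw [interior_Ico] at hy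
      exact (hd y ⟨hy.1.le, hy.2⟩).differentiableAt.differentiableWithinAt
    · intro y hy
      rw [interior_Ico] at hy
      rw [(hd y ⟨hy.1.le, hy.2⟩).deriv]
      linarith [aux_logdiff hy.1.le hy.2]
  have := hmono (a := 0) (b := x) ⟨le_rfl, one_pos⟩ ⟨h0, h1⟩ h0
  simp [g] at this
  linarith

lemma aux_H_upper {a : ℝ} (h0 : 1 / 2 ≤ a) (h1 : a < 1) :
    Hent a ≤ Real.log 2 - (2 * a - 1) ^ 2 / 2 := by
  have h := aux_pinsker (x := 2 * a - 1) (by linarith) (by linarith)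
  have e1 : 1 + (2 * a - 1) = 2 * a := by ring
  have e2 : 1 - (2 * a - 1) = 2 * (1 - a) := by ring
  rw [e1, e2, Real.log_mul (by norm_num) (by linarith),
    Real.log_mul (by norm_num) (by linarith)] at h
  unfold Hent
  nlinarith

lemma aux_H_nonneg {a : ℝ} (h0 : 0 < a) (h1 : a < 1) : 0 ≤ Hent a :=
  le_trans (by have : 0 < 1 - a := by linarith
               positivity) (aux_H_lower h0 h1)

lemma aux_sq_lt {l : ℝ} (h : 9 / 5 < l) : l ^ 2 < fEx l := by
  unfold fEx
  have h1 := Real.sum_le_exp_of_nonneg (x := l) (by linarith) 8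
  simp only [Finset.sum_range_succ, Finset.sum_range_zero, Nat.factorial] at h1
  norm_num at h1
  have h0 : 0 < l ^ 2 := by positivity
  have k3 : (9/5:ℝ) ^ 1 ≤ l ^ 1 := by gcongr
  have k4 : (9/5:ℝ) ^ 2 ≤ l ^ 2 := by gcongr
  have k5 : (9/5:ℝ) ^ 3 ≤ l ^ 3 := by gcongr
  have k6 : (9/5:ℝ) ^ 4 ≤ l ^ 4 := by gcongr
  have k7 : (9/5:ℝ) ^ 5 ≤ l ^ 5 := by gcongr
  have : 1 / 2 < l ^ 1 / 6 + l ^ 2 / 24 + l ^ 3 / 120 + l ^ 4 / 720 + l ^ 5 / 5040 := by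
    norm_num at *
    linarith
  nlinarith

lemma aux_large {k : ℕ} {c l : ℝ} (hc0 : 0 < c) (hc1 : c < 1) (hl : 9 / 5 < l) :
    ∃ e : ℝ, 0 < e ∧ ∀ a : ℝ, 1 / 2 < a → a < 1 → HkF k a a (1 - a) c l ≤ -e := by
  have hf := aux_sq_lt hl
  have hfp : 0 < fEx l := aux_fpos (by linarith)
  set d := max c (l ^ 2 / fEx l) with hd
  have hd1 : d < 1 := max_lt hc1 ((div_lt_one hfp).2 hf)
  have hl2 := Real.log_pos (show (1:ℝ) < 2 by norm_num)
  refine ⟨(1 - d) * Real.log 2, by nlinarith, ?_⟩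
  intro a ha ha1
  unfold HkF
  rw [div_self (by linarith), div_self (by linarith), Real.log_one]
  have e1 : l * (1 - a + a) = l := by ring
  have e2 : l * (1 - a - a) = -(l * (2 * a - 1)) := by ring
  rw [e1, e2]
  have hx : 0 < 2 * a - 1 := by linarith
  have hy : 0 < l * (2 * a - 1) := by
    apply mul_pos _ hx
    linarith
  have hfn := aux_f_neg hy.le
  have hfn0 : 0 < fEx (-(l * (2 * a - 1))) := aux_fpos (by linarith)
  set r := fEx (-(l * (2 * a - 1))) / fEx l with hr
  have hr0 : 0 < r := div_pos hfn0 hfp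
  have e3 : (fEx l + fEx (-(l * (2 * a - 1)))) / (2 * fEx l) = (1 + r) / 2 := by
    rw [hr]; field_simp
  rw [e3, Real.log_div (by positivity) (by norm_num)]
  have h4 : Real.log (1 + r) ≤ r := by
    have := Real.log_le_sub_one_of_pos (show 0 < 1 + r by positivity); linarith
  have h5 : r ≤ d * ((2 * a - 1) ^ 2 / 2) := by
    calc r ≤ (l * (2 * a - 1)) ^ 2 / 2 / fEx l := by rw [hr]; gcongr
      _ = l ^ 2 / fEx l * ((2 * a - 1) ^ 2 / 2) := by field_simp
      _ ≤ _ := by gcongr; exact le_max_right _ _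
  have h6 : c * Hent a ≤ d * (Real.log 2 - (2 * a - 1) ^ 2 / 2) := by
    have hH := aux_H_nonneg (by linarith) ha1
    calc c * Hent a ≤ d * Hent a := by gcongr; exact le_max_left _ _
      _ ≤ _ := by
        apply mul_le_mul_of_nonneg_left (aux_H_upper ha.le ha1)
        exact hc0.le.trans (le_max_left _ _)
  nlinarith

/-- moments -/
noncomputable def pm (u v : ℝ) (n : ℕ) : ℝ := ((v + u) ^ n + (v - u) ^ n) / 2

/-- bound constants -/
noncomputable def KK (n : ℕ) : ℝ := (if n % 2 = 0 then 2 else 3) * 2 ^ (n / 2) - 4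

lemma aux_even {u v : ℝ} (h : u ^ 2 + v ^ 2 = 1) (m : ℕ) :
    pm u v (2 * m + 4) = 2 * pm u v (2 * m + 2) - (1 - 4 * (u ^ 2 * v ^ 2)) * pm u v (2 * m) := by
  unfold pm
  have e1 : (v + u) ^ 4 = 2 * (v + u) ^ 2 - (1 - 4 * (u ^ 2 * v ^ 2)) := by
    have : (v + u) ^ 2 = 1 + 2 * (u * v) := by rw [← h]; ring
    have e : (v + u) ^ 4 = ((v + u) ^ 2) ^ 2 := by ring
    rw [e, this]; ring
  have e2 : (v - u) ^ 4 = 2 * (v - u) ^ 2 - (1 - 4 * (u ^ 2 * v ^ 2)) := by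
    have : (v - u) ^ 2 = 1 - 2 * (u * v) := by rw [← h]; ring
    have e : (v - u) ^ 4 = ((v - u) ^ 2) ^ 2 := by ring
    rw [e, this]; ring
  rw [pow_add (v + u) (2 * m) 4, pow_add (v - u) (2 * m) 4, e1, e2]
  ring

lemma aux_q {u v : ℝ} (h : u ^ 2 + v ^ 2 = 1) : 4 * (u ^ 2 * v ^ 2) ≤ 1 := by
  nlinarith [sq_nonneg (u ^ 2 - v ^ 2)]

lemma aux_even_ge {u v : ℝ} (h : u ^ 2 + v ^ 2 = 1) (m : ℕ) :
    1 ≤ pm u v (2 * m) ∧ pm u v (2 * m) ≤ pm u v (2 * m + 2) := by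
  have hq := aux_q h
  have hq0 : 0 ≤ u ^ 2 * v ^ 2 := by positivity
  induction m with
  | zero =>
    have : pm u v 2 = 1 := by unfold pm; rw [← h]; ring
    have h0 : pm u v 0 = 1 := by unfold pm; norm_num
    simp [this, h0]
  | succ m ih =>
    have := aux_even h m
    have e : 2 * (m + 1) = 2 * m + 2 := by ring
    have e' : 2 * m + 2 + 2 = 2 * m + 4 := by ring
    rw [e, e', this]
    refine ⟨ih.1.trans ih.2, ?_⟩
    have := mul_nonneg hq0 (zero_le_one.trans ih.1)
    linarith [ih.2]

lemma aux_even_le {u v : ℝ} (h : u ^ 2 + v ^ 2 = 1) (m : ℕ) :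
    pm u v (2 * m + 2) ≤ 1 + (2 ^ (m + 2) - 4) * (u ^ 2 * v ^ 2) := by
  have hq := aux_q h
  have hq0 : 0 ≤ u ^ 2 * v ^ 2 := by positivity
  induction m with
  | zero =>
    have : pm u v 2 = 1 := by unfold pm; rw [← h]; ring
    norm_num [this]
  | succ m ih =>
    have := aux_even h m
    have h1 := (aux_even_ge h m).1
    have e : 2 * (m + 1) + 2 = 2 * m + 4 := by ring
    rw [e, this, show (2:ℝ) ^ (m + 1 + 2) = 2 * 2 ^ (m + 2) by ring]
    nlinarith [mul_le_mul_of_nonneg_left h1 (sub_nonneg.2 hq)]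

lemma aux_odd {u v : ℝ} (m : ℕ) :
    pm u v (2 * m + 1) ≤ (pm u v (2 * m) + pm u v (2 * m + 2)) / 2 := by
  unfold pm
  have key : ∀ x : ℝ, 0 ≤ x ^ (2 * m) - 2 * x ^ (2 * m + 1) + x ^ (2 * m + 2) := by
    intro x
    have : x ^ (2 * m) - 2 * x ^ (2 * m + 1) + x ^ (2 * m + 2) = (x ^ m * (x - 1)) ^ 2 := by ring
    rw [this]; positivity
  linarith [key (v + u), key (v - u)]

lemma aux_pm_le {u v : ℝ} (h : u ^ 2 + v ^ 2 = 1) (n : ℕ) (hn : 2 ≤ n) :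
    pm u v n ≤ 1 + KK n * (u ^ 2 * v ^ 2) := by
  rcases Nat.even_or_odd' n with ⟨m, rfl | rfl⟩
  · obtain ⟨j, rfl⟩ : ∃ j, m = j + 1 := ⟨m - 1, by omega⟩
    have := aux_even_le h j
    have e : KK (2 * (j + 1)) = 2 ^ (j + 2) - 4 := by
      unfold KK
      rw [if_pos (by omega), show 2 * (j + 1) / 2 = j + 1 by omega]; ring
    rw [e]; exact this
  · obtain ⟨j, rfl⟩ : ∃ j, m = j + 1 := ⟨m - 1, by omega⟩
    have h1 := aux_even_le h j
    have h2 := aux_even_le h (j + 1)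
    have h3 := aux_odd (u := u) (v := v) (j + 1)
    have e : KK (2 * (j + 1) + 1) = ((2 ^ (j + 2) - 4) + (2 ^ (j + 1 + 2) - 4)) / 2 := by
      unfold KK
      rw [if_neg (by omega), show (2 * (j + 1) + 1) / 2 = j + 1 by omega]; ring
    rw [e]
    rw [show 2 * (j + 1) = 2 * j + 2 by ring] at *
    linarith

lemma aux_KK_le (n : ℕ) (hn : 10 ≤ n) : KK n ≤ 2 ^ n / 4 := by
  have hb : KK n ≤ 3 * 2 ^ (n / 2) := by
    unfold KK
    have : (0:ℝ) < 2 ^ (n / 2) := by positivity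
    split_ifs <;> linarith
  refine hb.trans ?_
  have h1 : (2:ℝ) ^ (n / 2 + 4) ≤ 2 ^ n := pow_le_pow_right₀ (by norm_num) (by omega)
  rw [pow_add] at h1
  have : (0:ℝ) < 2 ^ (n / 2) := by positivity
  linarith

lemma aux_hasSum_exp (x : ℝ) : HasSum (fun n : ℕ => x ^ n / (n.factorial : ℝ)) (Real.exp x) := by
  rw [Real.exp_eq_exp_ℝ]
  exact NormedSpace.expSeries_div_hasSum_exp x

lemma aux_tail {x : ℝ} (h0 : 0 ≤ x) (h1 : x ≤ 5) :
    Real.exp x - ∑ m ∈ Finset.range 10, x ^ m / (m.factorial : ℝ) ≤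
      x ^ 10 / ((10:ℕ).factorial : ℝ) * 2 := by
  have hn : ‖(x : ℂ)‖ = x := by rw [Complex.norm_real, Real.norm_of_nonneg h0]
  have h := Complex.exp_bound' (x := (x : ℂ)) (n := 10) (by
    rw [hn]; norm_num; linarith)
  rw [hn] at h
  have e : Complex.exp x - ∑ m ∈ Finset.range 10, (x : ℂ) ^ m / (m.factorial : ℂ) =
      ((Real.exp x - ∑ m ∈ Finset.range 10, x ^ m / (m.factorial : ℝ) : ℝ) : ℂ) := by
    push_cast; rfl
  rw [e, Complex.norm_real] at h
  exact (le_abs_self _).trans h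

lemma aux_sumbound {l u v : ℝ} (hl : 0 < l) (hl1 : l ≤ 9 / 5) (h : u ^ 2 + v ^ 2 = 1) :
    (fEx (l * (v + u)) + fEx (l * (v - u))) / 2 ≤ fEx l +
      (l ^ 3 / 3 + l ^ 4 / 6 + l ^ 5 / 15 + l ^ 6 / 60 + l ^ 7 / 252 + l ^ 8 / 1440
        + 44 * l ^ 9 / 362880 + (2 * l) ^ 10 / 7257600) * (u ^ 2 * v ^ 2) := by
  have hq0 : 0 ≤ u ^ 2 * v ^ 2 := by positivity
  set q := u ^ 2 * v ^ 2 with hq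
  let F : ℕ → ℝ := fun n => l ^ n / (n.factorial : ℝ) * (pm u v n - 1)
  have hF : HasSum F ((Real.exp (l * (v + u)) + Real.exp (l * (v - u))) / 2 - Real.exp l) := by
    have := (((aux_hasSum_exp (l * (v + u))).add (aux_hasSum_exp (l * (v - u)))).div_const 2).sub
      (aux_hasSum_exp l)
    refine this.congr_fun ?_
    intro n
    simp only [F, pm, mul_pow]
    ring
  have hF' := (hasSum_nat_add_iff' 10).2 hF
  have hG := (hasSum_nat_add_iff' 10).2 (((aux_hasSum_exp (2 * l)).div_const 4).mul_right q)
  have hle := hasSum_le (fun n => by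
    simp only [F]
    have h1 := aux_pm_le h (n + 10) (by omega)
    have h2 := aux_KK_le (n + 10) (by omega)
    have h3 : pm u v (n + 10) - 1 ≤ 2 ^ (n + 10) / 4 * q := by nlinarith
    calc l ^ (n + 10) / ((n + 10).factorial : ℝ) * (pm u v (n + 10) - 1)
        ≤ l ^ (n + 10) / ((n + 10).factorial : ℝ) * (2 ^ (n + 10) / 4 * q) := by gcongr
      _ = (2 * l) ^ (n + 10) / ((n + 10).factorial : ℝ) / 4 * q := by rw [mul_pow]; ring) hF' hG
  have ht := aux_tail (x := 2 * l) (by linarith) (by linarith)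
  have hG2 : Real.exp (2 * l) / 4 * q - ∑ i ∈ Finset.range 10, (2 * l) ^ i / (i.factorial : ℝ) / 4 * q
      ≤ (2 * l) ^ 10 / 7257600 * q := by
    rw [← Finset.sum_mul, ← Finset.sum_div, ← sub_mul, ← sub_div]
    apply mul_le_mul_of_nonneg_right _ hq0
    norm_num [Nat.factorial] at ht ⊢
    linarith
  have hb := hle.trans hG2
  have hFn : ∀ n, 2 ≤ n → F n ≤ l ^ n / (n.factorial : ℝ) * (KK n * q) := by
    intro n hn
    simp only [F]
    have := aux_pm_le h n hn
    gcongr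
    linarith
  have f0 : F 0 = 0 := by simp [F, pm]
  have f1 : F 1 = l * v - l := by simp [F, pm]; ring
  have f2 := hFn 2 (by norm_num)
  have f3 := hFn 3 (by norm_num)
  have f4 := hFn 4 (by norm_num)
  have f5 := hFn 5 (by norm_num)
  have f6 := hFn 6 (by norm_num)
  have f7 := hFn 7 (by norm_num)
  have f8 := hFn 8 (by norm_num)
  have f9 := hFn 9 (by norm_num)
  norm_num [KK, Nat.factorial] at f2 f3 f4 f5 f6 f7 f8 f9
  simp only [Finset.sum_range_succ, Finset.sum_range_zero, f0, f1] at hb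
  unfold fEx
  linarith

lemma aux_poly {l : ℝ} (hl : 0 < l) (hl1 : l ≤ 9 / 5) :
    l ^ 3 / 3 + l ^ 4 / 6 + l ^ 5 / 15 + l ^ 6 / 60 + l ^ 7 / 252 + l ^ 8 / 1440
        + 44 * l ^ 9 / 362880 + (2 * l) ^ 10 / 7257600 < 2 / 3 * (l * (Real.exp l - 1)) := by
  have h1 := Real.sum_le_exp_of_nonneg hl.le 9
  simp only [Finset.sum_range_succ, Finset.sum_range_zero, Nat.factorial] at h1
  norm_num at h1
  have h2 := mul_le_mul_of_nonneg_left h1 hl.le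
  have k : ∀ n : ℕ, l ^ (n + 2) ≤ (9 / 5) ^ n * l ^ 2 := by
    intro n
    rw [pow_add]
    gcongr
  have k2 := k 2
  have k3 := k 3
  have k4 := k 4
  have k5 := k 5
  have k6 := k 6
  have k7 := k 7
  have k8 := k 8
  norm_num at k2 k3 k4 k5 k6 k7 k8
  have h0 : 0 < l ^ 2 := by positivity
  rw [mul_pow]
  nlinarith

lemma aux_small {k : ℕ} (hk : 4 ≤ k) {c l : ℝ} (hc0 : 0 < c) (hl : 0 < l) (hl1 : l ≤ 9 / 5)
    (hs : c * k * fEx l = l * (Real.exp l - 1)) (d : ℝ) (hd : 0 < d) :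
    ∃ e : ℝ, 0 < e ∧ ∀ a : ℝ, 1 / 2 < a → a ≤ 1 - d →
      HkF k a (Real.sqrt a) (Real.sqrt (1 - a)) c l ≤ -e := by
  have hfp : 0 < fEx l := aux_fpos hl.ne'
  have hp := aux_poly hl hl1
  set A := l ^ 3 / 3 + l ^ 4 / 6 + l ^ 5 / 15 + l ^ 6 / 60 + l ^ 7 / 252 + l ^ 8 / 1440
        + 44 * l ^ 9 / 362880 + (2 * l) ^ 10 / 7257600 with hA
  have hA2 : A / fEx l < 2 / 3 * (c * k) := by
    rw [div_lt_iff₀ hfp]; linarith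
  have hA0 : 0 ≤ A := by positivity
  set D := 2 / 3 * (c * k) - A / fEx l with hD
  have hD0 : 0 < D := by linarith
  refine ⟨d / 2 * D, by positivity, ?_⟩
  intro a ha had
  have ha0 : 0 < a := by linarith
  have hb0 : 0 < 1 - a := by linarith
  have su := Real.sq_sqrt ha0.le
  have sv := Real.sq_sqrt hb0.le
  have pu := Real.sqrt_pos.2 ha0
  have pv := Real.sqrt_pos.2 hb0
  have hsum := aux_sumbound (u := Real.sqrt a) (v := Real.sqrt (1 - a)) hl hl1 (by linarith)
  rw [su, sv, ← hA] at hsum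
  have l1 : Real.log (a / Real.sqrt a) = Real.log a / 2 := by
    rw [Real.div_sqrt, Real.log_sqrt ha0.le]
  have l2 : Real.log ((1 - a) / Real.sqrt (1 - a)) = Real.log (1 - a) / 2 := by
    rw [Real.div_sqrt, Real.log_sqrt hb0.le]
  unfold HkF
  rw [l1, l2]
  set N := fEx (l * (Real.sqrt (1 - a) + Real.sqrt a)) + fEx (l * (Real.sqrt (1 - a) - Real.sqrt a))
  have hN : 0 < N := by
    apply add_pos_of_pos_of_nonneg
    · exact aux_fpos (by positivity)
    · unfold fEx
      linarith [Real.add_one_le_exp (l * (Real.sqrt (1 - a) - Real.sqrt a))]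
  have hlog : Real.log (N / (2 * fEx l)) ≤ A / fEx l * (a * (1 - a)) := by
    have h1 := Real.log_le_sub_one_of_pos (show 0 < N / (2 * fEx l) by positivity)
    have h2 : N / (2 * fEx l) ≤ 1 + A / fEx l * (a * (1 - a)) := by
      rw [div_le_iff₀ (by positivity)]
      have : (1 + A / fEx l * (a * (1 - a))) * (2 * fEx l) = 2 * (fEx l + A * (a * (1 - a))) := by
        field_simp
      rw [this]; linarith
    linarith
  have hH := aux_H_lower ha0 (by linarith)
  have hHe : c * k * a * (Real.log a / 2) + c * k * (1 - a) * (Real.log (1 - a) / 2)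
      = -(c * k / 2 * Hent a) := by
    unfold Hent; ring
  have hk' : (4:ℝ) ≤ k := by exact_mod_cast hk
  have hH0 : 0 ≤ Hent a := le_trans (by positivity) hH
  have t1 : c * Hent a ≤ c * k / 4 * Hent a := by
    apply mul_le_mul_of_nonneg_right _ hH0
    have := mul_le_mul_of_nonneg_left hk' hc0.le
    linarith
  have t2 : c * k / 4 * (8 / 3 * (a * (1 - a))) ≤ c * k / 4 * Hent a := by gcongr
  have t3 : d / 2 * D ≤ (a * (1 - a)) * D := by
    apply mul_le_mul_of_nonneg_right _ hD0.le
    have := mul_le_mul_of_nonneg_right ha.le hb0.le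
    linarith
  have t4 : (a * (1 - a)) * D = c * k / 4 * (8 / 3 * (a * (1 - a))) - A / fEx l * (a * (1 - a)) := by
    rw [hD]; ring
  linarith

lemma aux_end {c l : ℝ} (hl : 0 < l) :
    ∃ e : ℝ, 0 < e ∧ ∃ z : ℝ, 0 < z ∧ ∃ d : ℝ, 0 < d ∧ d ≤ z ∧ d < 1 / 2 ∧
      (∀ b : ℝ, 0 ≤ b → b < d → c * Hent (1 - b) ≤ e) ∧
      Real.log ((fEx (l * (z + 1)) + fEx (l * (z - 1))) / (2 * fEx l)) ≤ -(2 * e) := by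
  have hfp : 0 < fEx l := aux_fpos hl.ne'
  have hfn : 0 < fEx (-l) := aux_fpos (by linarith)
  have hlt : fEx (-l) < fEx l := by
    have h1 := Real.self_lt_sinh_iff.2 hl
    rw [Real.sinh_eq] at h1
    unfold fEx; linarith
  let g : ℝ → ℝ := fun z => Real.log ((fEx (l * (z + 1)) + fEx (l * (z - 1))) / (2 * fEx l))
  have g0 : g 0 < 0 := by
    simp only [g]
    apply Real.log_neg
    · have : 0 < fEx l + fEx (-l) := by linarith
      simp
      positivity
    · rw [div_lt_one (by positivity)]; simp; linarith
  have gc : ContinuousAt g 0 := by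
    simp only [g]
    apply ContinuousAt.log
    · apply Continuous.continuousAt
      unfold fEx
      fun_prop
    · have : (fEx l + fEx (-l)) / (2 * fEx l) ≠ 0 := by positivity
      simpa using this
  have hc : Continuous (fun b : ℝ => c * Hent (1 - b)) := by
    have h1 := Real.continuous_mul_log
    have h2 : Continuous (fun b : ℝ => (1 - b) * Real.log (1 - b)) :=
      h1.comp (continuous_const.sub continuous_id)
    have h3 : Continuous (fun b : ℝ => (1 - (1 - b)) * Real.log (1 - (1 - b))) := by
      simpa using h1
    unfold Hent
    exact continuous_const.mul (h2.neg.sub h3)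
  have hev := gc.eventually (gt_mem_nhds (show g 0 < g 0 / 2 by linarith))
  obtain ⟨z1, hz1, hz⟩ := Metric.eventually_nhds_iff.1 hev
  have hev2 := hc.continuousAt.eventually (gt_mem_nhds (show c * Hent (1 - 0) < -g 0 / 4 by
    simp [Hent]; linarith))
  obtain ⟨d1, hd1, hd⟩ := Metric.eventually_nhds_iff.1 hev2
  refine ⟨-g 0 / 4, by linarith, z1 / 2, by linarith, min d1 (min (z1 / 2) (1 / 4)), ?_, ?_, ?_, ?_, ?_⟩
  · positivity
  · exact (min_le_right _ _).trans (min_le_left _ _)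
  · exact ((min_le_right _ _).trans (min_le_right _ _)).trans_lt (by norm_num)
  · intro b hb hbd
    refine (hd ?_).le
    rw [Real.dist_eq, sub_zero, abs_of_nonneg hb]
    exact hbd.trans_le (min_le_left _ _)
  · have := hz (y := z1 / 2) (by rw [Real.dist_eq, sub_zero, abs_of_pos] <;> linarith)
    have e : g (z1 / 2) = Real.log ((fEx (l * (z1 / 2 + 1)) + fEx (l * (z1 / 2 - 1))) / (2 * fEx l)) := rfl
    rw [← e]; linarith

theorem Hk_large_alpha (k : ℕ) (hk : 4 ≤ k) (c : ℝ) (hc : 2 / k < c) (hc1 : c < 1)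
    (lam : ℝ) (hlam : 0 < lam) (hroot : psi lam = c * k) :
    ∃ ε : ℝ, 0 < ε ∧ ∃ ζ₀ : ℝ, 0 < ζ₀ ∧
      ∀ a : ℝ, 1 / 2 < a → a ≤ 1 →
        ∃ z1 z2 : ℝ, 0 < z1 ∧ ζ₀ ≤ z2 ∧ HkF k a z1 z2 c lam ≤ -ε := by
  have hk' : (4:ℝ) ≤ k := by exact_mod_cast hk
  have hc0 : 0 < c := lt_trans (by positivity) hc
  have hfp : 0 < fEx lam := aux_fpos hlam.ne'
  have hs : c * k * fEx lam = lam * (Real.exp lam - 1) := by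
    rw [← hroot, psi, if_neg hlam.ne']
    exact div_mul_cancel₀ _ hfp.ne'
  obtain ⟨e, he, z, hz, d, hd, hdz, hd2, hH, hlog⟩ := aux_end (c := c) hlam
  have bulk : ∃ e' : ℝ, 0 < e' ∧ ∀ a : ℝ, 1 / 2 < a → a ≤ 1 - d →
      ∃ z1 z2 : ℝ, 0 < z1 ∧ d ≤ z2 ∧ HkF k a z1 z2 c lam ≤ -e' := by
    rcases le_or_gt lam (9 / 5) with h | h
    · obtain ⟨e', he', hb⟩ := aux_small hk hc0 hlam h hs d hd
      refine ⟨e', he', fun a ha had => ⟨_, _, ?_, ?_, hb a ha had⟩⟩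
      · exact Real.sqrt_pos.2 (by linarith)
      · apply Real.le_sqrt_of_sq_le
        nlinarith
    · obtain ⟨e', he', hb⟩ := aux_large (k := k) hc0 hc1 h
      exact ⟨e', he', fun a ha had => ⟨_, _, by linarith, by linarith, hb a ha (by linarith)⟩⟩
  obtain ⟨e', he', hb⟩ := bulk
  refine ⟨min e e', lt_min he he', d, hd, ?_⟩
  intro a ha ha1
  rcases le_or_gt a (1 - d) with h | h
  · obtain ⟨z1, z2, h1, h2, h3⟩ := hb a ha h
    exact ⟨z1, z2, h1, h2, h3.trans (neg_le_neg (min_le_right _ _))⟩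
  · refine ⟨1, z, one_pos, hdz, ?_⟩
    have h1 := hH (1 - a) (by linarith) (by linarith)
    rw [sub_sub_cancel] at h1
    unfold HkF
    have t1 : c * k * a * Real.log (a / 1) ≤ 0 := by
      rw [div_one]
      exact mul_nonpos_of_nonneg_of_nonpos (by positivity) (Real.log_nonpos (by linarith) ha1)
    have t2 : c * k * (1 - a) * Real.log ((1 - a) / z) ≤ 0 := by
      have hb0 : 0 ≤ 1 - a := by linarith
      refine mul_nonpos_of_nonneg_of_nonpos (by positivity)
        (Real.log_nonpos (by positivity) ((div_le_one hz).2 (by linarith)))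
    have := min_le_left e e'
    linarith
end

section
/- Let f(x) = e^x − 1 − x. The function x ↦ (1/x)·ln(f(x)/x²) is strictly increasing on (0, ∞); equivalently, G(x) := ln(f(x)/x²) + 2 − x f′(x)/f(x) < 0 for every x > 0. -/
lemma aux_tanh {x : ℝ} (hx : 0 < x) : 0 < x * (Real.exp x + 1) - 2 * (Real.exp x - 1) := by
  have hd : ∀ y : ℝ, HasDerivAt (fun x : ℝ => x * (Real.exp x + 1) - 2 * (Real.exp x - 1))
      (1 * (Real.exp y + 1) + y * Real.exp y - 2 * Real.exp y) y := fun y =>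
    ((hasDerivAt_id y).mul ((Real.hasDerivAt_exp y).add_const 1)).sub
      (((Real.hasDerivAt_exp y).sub_const 1).const_mul 2)
  have hm : StrictMonoOn (fun x : ℝ => x * (Real.exp x + 1) - 2 * (Real.exp x - 1)) (Set.Ici 0) := by
    apply strictMonoOn_of_deriv_pos (convex_Ici 0)
    · exact fun y _ => (hd y).continuousAt.continuousWithinAt
    · intro y hy
      rw [interior_Ici] at hy
      rw [(hd y).deriv]
      have h1 := Real.add_one_lt_exp (neg_ne_zero.mpr (ne_of_gt hy))
      have h2 : Real.exp y * Real.exp (-y) = 1 := by rw [← Real.exp_add]; simp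
      nlinarith [Real.exp_pos y]
  have := hm (Set.mem_Ici.mpr le_rfl) (Set.mem_Ici.mpr hx.le) hx
  simpa using this

lemma aux_cubic {x : ℝ} (hx : 0 < x) (hx3 : x ≤ 3) :
    Real.exp x < 1 + x + x ^ 2 / 2 + x ^ 3 / 2 := by
  set h : ℝ → ℝ := fun x => (1 + x + x ^ 2 / 2 + x ^ 3 / 2) * Real.exp (-x) with hh
  have hd : ∀ y : ℝ, HasDerivAt h (Real.exp (-y) * (y ^ 2 * (1 - y / 2))) y := by
    intro y
    have h1 : HasDerivAt (fun x : ℝ => 1 + x + x ^ 2 / 2 + x ^ 3 / 2)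
        (1 + (2 * y) / 2 + (3 * y ^ 2) / 2) y := by
      have a := ((hasDerivAt_id y).const_add 1).add ((hasDerivAt_pow 2 y).div_const 2)
      have b := a.add ((hasDerivAt_pow 3 y).div_const 2)
      exact HasDerivAt.congr_deriv b (by norm_num)
    have h2 := h1.mul ((hasDerivAt_neg y).exp)
    exact HasDerivAt.congr_deriv h2 (by ring)
  have key : 1 < h x := by
    rcases le_total x 2 with h2 | h2
    · have hm : StrictMonoOn h (Set.Icc 0 2) := by
        apply strictMonoOn_of_deriv_pos (convex_Icc 0 2)
        · exact fun y _ => (hd y).continuousAt.continuousWithinAt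
        · intro y hy
          rw [interior_Icc] at hy
          rw [(hd y).deriv]
          have := hy.1
          have : 0 < 1 - y / 2 := by linarith [hy.2]
          positivity
      have := hm (Set.mem_Icc.mpr ⟨le_rfl, by norm_num⟩) (Set.mem_Icc.mpr ⟨hx.le, h2⟩) hx
      simpa [hh] using this
    · have hm : AntitoneOn h (Set.Ici 2) := by
        apply antitoneOn_of_deriv_nonpos (convex_Ici 2)
        · exact fun y _ => (hd y).continuousAt.continuousWithinAt
        · exact fun y _ => (hd y).differentiableAt.differentiableWithinAt
        · intro y hy
          rw [interior_Ici] at hy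
          rw [(hd y).deriv]
          have h0 : 1 - y / 2 ≤ 0 := by linarith [Set.mem_Ioi.mp hy]
          exact mul_nonpos_of_nonneg_of_nonpos (Real.exp_pos _).le
            (mul_nonpos_of_nonneg_of_nonpos (sq_nonneg _) h0)
      have h3 := hm (Set.mem_Ici.mpr h2) (Set.mem_Ici.mpr (by norm_num : (2:ℝ) ≤ 3)) hx3
      refine lt_of_lt_of_le ?_ h3
      have e1 : Real.exp 3 < 22 := by
        have : Real.exp 3 = Real.exp 1 ^ 3 := by rw [← Real.exp_nat_mul]; norm_num
        rw [this]
        calc Real.exp 1 ^ 3 < 2.72 ^ 3 := by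
              gcongr; linarith [Real.exp_one_lt_d9]
          _ < 22 := by norm_num
      have e2 : Real.exp 3 * Real.exp (-3) = 1 := by rw [← Real.exp_add]; simp
      simp only [hh]
      nlinarith [Real.exp_pos (-3)]
  have e2 : Real.exp x * Real.exp (-x) = 1 := by rw [← Real.exp_add]; simp
  simp only [hh] at key
  exact lt_of_mul_lt_mul_right (e2.trans_lt key) (Real.exp_pos _).le

lemma G_neg (x : ℝ) (hx : 0 < x) :
    Real.log (fEx x / x ^ 2) + 2 - x * (Real.exp x - 1) / fEx x < 0 := by
  have hf := fEx_pos hx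
  have hx2 : 0 < x ^ 2 := by positivity
  have hR : x * (Real.exp x - 1) / fEx x = x + x ^ 2 / fEx x := by
    field_simp
    unfold fEx; ring
  rw [hR]
  have ht : 0 < fEx x / x ^ 2 := by positivity
  rcases le_total x 3 with h3 | h3
  · rcases le_total (fEx x) (x ^ 2) with h | h
    · have : Real.log (fEx x / x ^ 2) ≤ 0 :=
        Real.log_nonpos ht.le ((div_le_one hx2).mpr h)
      have h5 : 2 < x + x ^ 2 / fEx x := by
        have h6 : 2 - x < x ^ 2 / fEx x := by
          rw [lt_div_iff₀ hf]
          have := aux_tanh hx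
          unfold fEx
          nlinarith
        linarith
      linarith
    · have hc := aux_cubic hx h3
      have h1 : 1 ≤ fEx x / x ^ 2 := (one_le_div hx2).mpr h
      have h2 : fEx x / x ^ 2 < (x + 1) / 2 := by
        rw [div_lt_iff₀ hx2]; unfold fEx; nlinarith
      have hl := Real.log_le_sub_one_of_pos ht
      have he : x ^ 2 / fEx x = (fEx x / x ^ 2)⁻¹ := by rw [inv_div]
      rw [he]
      generalize fEx x / x ^ 2 = t at *
      have : 2 - t ≤ t⁻¹ := by
        rw [← one_div, le_div_iff₀ ht]
        nlinarith [sq_nonneg (t - 1)]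
      linarith
  · have hl : Real.log (fEx x / x ^ 2) < x - 2 * Real.log x := by
      rw [Real.log_div hf.ne' hx2.ne', Real.log_pow]
      have : Real.log (fEx x) < x := by
        rw [Real.log_lt_iff_lt_exp hf]; unfold fEx; linarith
      push_cast; linarith
    have : 1 < Real.log x := by
      rw [Real.lt_log_iff_exp_lt hx]; linarith [Real.exp_one_lt_d9]
    have : 0 < x ^ 2 / fEx x := by positivity
    linarith

theorem log_f_over_x_sq_strictMono :
    StrictMonoOn (fun x : ℝ => (1 / x) * Real.log (fEx x / x ^ 2)) (Set.Ioi 0) ∧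
    ∀ x : ℝ, 0 < x →
      Real.log (fEx x / x ^ 2) + 2 - x * (Real.exp x - 1) / fEx x < 0 := by
  refine ⟨?_, G_neg⟩
  have hd : ∀ x : ℝ, 0 < x → HasDerivAt (fun x : ℝ => (1 / x) * Real.log (fEx x / x ^ 2))
      (-(Real.log (fEx x / x ^ 2) + 2 - x * (Real.exp x - 1) / fEx x) / x ^ 2) x := by
    intro x hx
    have hf := fEx_pos hx
    have h1 : HasDerivAt fEx (Real.exp x - 1) x :=
      ((Real.hasDerivAt_exp x).sub_const 1).sub (hasDerivAt_id x)
    have h2 := (h1.div (hasDerivAt_pow 2 x) (by positivity)).log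
      (show fEx x / x ^ 2 ≠ 0 by positivity)
    have h3 := (hasDerivAt_inv hx.ne').mul h2
    simp only [one_div]
    refine HasDerivAt.congr_deriv h3 ?_
    simp only [Pi.div_apply]
    field_simp
    norm_num
    ring
  apply strictMonoOn_of_deriv_pos (convex_Ioi 0)
  · exact fun y hy => (hd y hy).continuousAt.continuousWithinAt
  · intro y hy
    rw [interior_Ioi] at hy
    rw [(hd y hy).deriv]
    have := G_neg y hy
    have h0 : 0 < y := hy
    apply div_pos <;> [linarith; positivity]
end

section
/- For every real x > 0, ln(2/(1 + e^{−x})) − x·e^{−x}/(1 + e^{−x}) ≥ (sinh x − x)/(1 + e^x) ≥ x³/(6(1 + e^x)). In particular, ln(2/(1 + e^{−x})) − x·e^{−x}/(1 + e^{−x}) ≥ x³/(6(1 + e^x)) > 0. -/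
theorem F_lower_bounds (x : ℝ) (hx : 0 < x) :
    (Real.sinh x - x) / (1 + Real.exp x) ≤
      Real.log (2 / (1 + Real.exp (-x))) - x * Real.exp (-x) / (1 + Real.exp (-x)) ∧
    x ^ 3 / (6 * (1 + Real.exp x)) ≤ (Real.sinh x - x) / (1 + Real.exp x) ∧
    0 < x ^ 3 / (6 * (1 + Real.exp x)) := by
  have hE : 0 < Real.exp x := Real.exp_pos x
  refine ⟨?_, ?_, by positivity⟩
  · have hl := Real.one_sub_inv_le_log_of_pos
      (show 0 < 2 / (1 + Real.exp (-x)) by positivity)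
    have h : (Real.sinh x - x) / (1 + Real.exp x) =
        1 - (2 / (1 + Real.exp (-x)))⁻¹ - x * Real.exp (-x) / (1 + Real.exp (-x)) := by
      rw [Real.sinh_eq, Real.exp_neg]
      field_simp
      ring
    linarith
  · have hs := Real.hasSum_sinh x
    have h := sum_le_hasSum (Finset.range 2) (fun i _ => by positivity) hs
    norm_num [Finset.sum_range_succ, Nat.factorial] at h
    rw [← div_div]
    gcongr
    linarith
end

section
/- For every real μ > 0, (e^μ + μ − 1)(e^μ − 1) − μ²(e^μ − 1 − μ) > 0. Consequently, for any integer k ≥ 3, if μ* > 0 satisfies μ*(e^{μ*} − 1)/(e^{μ*} − 1 − μ*) = k, then the function g_k(x) = x/(k(1 − e^{−x})^{k−1}) has g_k′(μ*) > 0. -/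
theorem gk_deriv_pos_at_root :
    (∀ μ : ℝ, 0 < μ →
      0 < (Real.exp μ + μ - 1) * (Real.exp μ - 1) - μ ^ 2 * (Real.exp μ - 1 - μ)) ∧
    ∀ k : ℕ, 3 ≤ k → ∀ μ : ℝ, 0 < μ →
      μ * (Real.exp μ - 1) / (Real.exp μ - 1 - μ) = k →
      0 < deriv (fun x : ℝ => x / ((k : ℝ) * (1 - Real.exp (-x)) ^ (k - 1))) μ := by
  have hs : ∀ μ : ℝ, Real.exp μ = Real.exp (μ / 2) * Real.exp (μ / 2) := by
    intro μ
    rw [← Real.exp_add]; congr 1; ring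
  constructor
  · intro μ hμ
    have h1 := Real.quadratic_le_exp_of_nonneg (x := μ / 2) (by positivity)
    have h2 : (μ - 1) ^ 2 ≤ Real.exp μ := by
      rw [hs μ]
      nlinarith [sq_nonneg (μ - 2)]
    have h3 : 0 < Real.exp μ - 1 - μ := by
      have := Real.add_one_lt_exp hμ.ne'
      linarith
    have h4 : 0 ≤ (Real.exp μ - 1 - μ) * (Real.exp μ - (μ - 1) ^ 2) :=
      mul_nonneg h3.le (by linarith)
    have h5 : 0 < μ ^ 2 := by positivity
    nlinarith
  · intro k hk μ hμ hroot
    have h3 : 0 < Real.exp μ - 1 - μ := by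
      have := Real.add_one_lt_exp hμ.ne'
      linarith
    rw [div_eq_iff h3.ne'] at hroot
    obtain ⟨n, rfl⟩ : ∃ n, k = n + 2 := ⟨k - 2, by omega⟩
    have hE : 0 < Real.exp μ - 1 := by linarith
    have hsinh : μ * Real.exp (μ / 2) < Real.exp μ - 1 := by
      have h := Real.self_lt_sinh_iff.2 (half_pos hμ)
      rw [Real.sinh_eq] at h
      have hp := Real.exp_pos (μ / 2)
      have h1 : Real.exp (μ / 2) * Real.exp (-(μ / 2)) = 1 := by
        rw [← Real.exp_add]; simp
      rw [hs μ]
      nlinarith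
    have hsq : μ ^ 2 * Real.exp μ < (Real.exp μ - 1) ^ 2 := by
      have hp := Real.exp_pos (μ / 2)
      have := pow_lt_pow_left₀ hsinh (by positivity) (two_ne_zero)
      calc μ ^ 2 * Real.exp μ = (μ * Real.exp (μ / 2)) ^ 2 := by rw [hs μ]; ring
        _ < _ := this
    have hkey : μ * ((n : ℝ) + 1) < Real.exp μ - 1 := by
      push_cast at hroot
      refine lt_of_mul_lt_mul_right ?_ h3.le
      nlinarith
    have hinv : Real.exp μ * Real.exp (-μ) = 1 := by
      rw [← Real.exp_add]; simp
    have hep := Real.exp_pos (-μ)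
    have hD : 0 < 1 - Real.exp (-μ) := by
      have : Real.exp (-μ) < 1 := by simpa using hμ
      linarith
    have hkey2 : μ * ((n : ℝ) + 1) * Real.exp (-μ) < 1 - Real.exp (-μ) := by
      have := mul_lt_mul_of_pos_right hkey hep
      linarith
    have hd : HasDerivAt (fun x : ℝ => 1 - Real.exp (-x)) (Real.exp (-μ)) μ := by
      have := ((hasDerivAt_neg μ).exp).const_sub 1
      simpa using this
    have hd2 := (hasDerivAt_id μ).div ((hd.pow (n + 1)).const_mul (((n + 2 : ℕ) : ℝ)))
      (by simp only [Pi.pow_apply]; positivity)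
    have hd3 : deriv (fun x : ℝ => x / (((n + 2 : ℕ) : ℝ) * (1 - Real.exp (-x)) ^ (n + 2 - 1))) μ = _ := hd2.deriv
    rw [hd3]
    apply div_pos
    · simp only [Pi.pow_apply, id, Nat.add_sub_cancel]
      have hpos : 0 < ((n : ℝ) + 2) * (1 - Real.exp (-μ)) ^ n *
          (1 - Real.exp (-μ) - μ * ((n : ℝ) + 1) * Real.exp (-μ)) := by
        have : 0 < 1 - Real.exp (-μ) - μ * ((n : ℝ) + 1) * Real.exp (-μ) := by linarith
        positivity
      push_cast
      refine hpos.trans_eq ?_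
      ring
    · simp only [Pi.pow_apply]
      positivity
end
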